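/- Harnack inequality in the limit: there exist constants C > 0 and ε₀ > 0, depending only on N, Λ, α, β, with the following property. Let ρ ≥ 0 and, for each ε ∈ (0, ε₀), let u_ε be a bounded Borel measurable function on ℝ^N with u_ε ≥ 0 in ℝ^N satisfying L_ε^+ u_ε ≥ −ρ and L_ε^- u_ε ≤ ρ in B_7. If u_ε converges uniformly on B_3 to a function u as ε → 0, then sup_{B_1} u ≤ C (inf_{B_1} u + ρ). -/

import Mathlib

open MeasureTheory Metric

/-- The second-order difference `δu(x,y) = u(x+y) + u(x−y) − 2u(x)`. -/
noncomputable def ddiff {N : ℕ} (u : EuclideanSpace ℝ (Fin N) → ℝ)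
    (x y : EuclideanSpace ℝ (Fin N)) : ℝ :=
  u (x + y) + u (x - y) - 2 * u x

/-- The maximal Pucci-type operator
`L_ε^+ u(x) = (1/(2ε²))(α·sup_{z ∈ B_Λ} δu(x,εz) + β·⨍_{B_1} δu(x,εy) dy)`. -/
noncomputable def Lplus {N : ℕ} (Λ α β ε : ℝ) (u : EuclideanSpace ℝ (Fin N) → ℝ)
    (x : EuclideanSpace ℝ (Fin N)) : ℝ :=
  (1 / (2 * ε ^ 2)) *
    (α * sSup ((fun z => ddiff u x (ε • z)) '' ball (0 : EuclideanSpace ℝ (Fin N)) Λ)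
      + β * ⨍ y in ball (0 : EuclideanSpace ℝ (Fin N)) 1, ddiff u x (ε • y))

/-- The minimal Pucci-type operator
`L_ε^- u(x) = (1/(2ε²))(α·inf_{z ∈ B_Λ} δu(x,εz) + β·⨍_{B_1} δu(x,εy) dy)`. -/
noncomputable def Lminus {N : ℕ} (Λ α β ε : ℝ) (u : EuclideanSpace ℝ (Fin N) → ℝ)
    (x : EuclideanSpace ℝ (Fin N)) : ℝ :=
  (1 / (2 * ε ^ 2)) *
    (α * sInf ((fun z => ddiff u x (ε • z)) '' ball (0 : EuclideanSpace ℝ (Fin N)) Λ)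
      + β * ⨍ y in ball (0 : EuclideanSpace ℝ (Fin N)) 1, ddiff u x (ε • y))

open scoped RealInnerProductSpace Pointwise Topology

/-- The second moment of the uniform distribution on the unit ball is nondegenerate. -/
theorem exists_second_moment_lower_bound (N : ℕ) :
    ∃ c : ℝ, 0 < c ∧ ∀ x : EuclideanSpace ℝ (Fin N),
      c * ‖x‖ ^ 2 ≤ ⨍ y in ball (0 : EuclideanSpace ℝ (Fin N)) 1, ⟪x, y⟫ ^ 2 := by
  refine ⟨(1 / 4) ^ N * (1 / 16), by positivity, fun x => ?_⟩
  rcases eq_or_ne x 0 with rfl | hx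
  · simp
  have hx0 : 0 < ‖x‖ := norm_pos_iff.2 hx
  set w : EuclideanSpace ℝ (Fin N) := (1 / (2 * ‖x‖)) • x with hw
  have hwn : ‖w‖ = 1 / 2 := by
    rw [hw, norm_smul, Real.norm_of_nonneg (by positivity)]
    field_simp
  have hinteg : IntegrableOn (fun y => ⟪x, y⟫ ^ 2) (ball (0 : EuclideanSpace ℝ (Fin N)) 1) volume :=
    ((by fun_prop : Continuous fun y => ⟪x, y⟫ ^ 2).continuousOn.integrableOn_compact
      (isCompact_closedBall (0 : EuclideanSpace ℝ (Fin N)) 1)).mono_set ball_subset_closedBall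
  have hsub : ball w (1 / 4) ⊆ ball (0 : EuclideanSpace ℝ (Fin N)) 1 :=
    ball_subset_ball' (by rw [dist_zero_right, hwn]; norm_num)
  have hlow : ∀ y ∈ ball w (1 / 4), ‖x‖ ^ 2 * (1 / 16) ≤ ⟪x, y⟫ ^ 2 := by
    intro y hy
    have h1 : ⟪x, w⟫ = ‖x‖ / 2 := by
      rw [hw, real_inner_smul_right, real_inner_self_eq_norm_sq]
      field_simp
    have h2 : ⟪x, y⟫ = ‖x‖ / 2 + ⟪x, y - w⟫ := by rw [← h1, ← inner_add_right]; congr 1; abel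
    have h3 := (abs_le.1 (abs_real_inner_le_norm x (y - w))).1
    have h4 : ‖y - w‖ ≤ 1 / 4 := (mem_ball_iff_norm.1 hy).le
    have h5 : ‖x‖ * ‖y - w‖ ≤ ‖x‖ * (1 / 4) := by gcongr
    have h6 : ‖x‖ * (1 / 4) ≤ ⟪x, y⟫ := by linarith
    calc ‖x‖ ^ 2 * (1 / 16) = (‖x‖ * (1 / 4)) ^ 2 := by ring
      _ ≤ _ := by gcongr
  have hvol : volume.real (ball w (1 / 4)) =
      (1 / 4) ^ N * volume.real (ball (0 : EuclideanSpace ℝ (Fin N)) 1) := by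
    rw [measureReal_def, Measure.addHaar_ball_of_pos _ _ (by norm_num), finrank_euclideanSpace_fin,
      ENNReal.toReal_mul, ENNReal.toReal_ofReal (by positivity), measureReal_def]
  have hpos : 0 < volume.real (ball (0 : EuclideanSpace ℝ (Fin N)) 1) :=
    ENNReal.toReal_pos (measure_ball_pos _ _ one_pos).ne' measure_ball_lt_top.ne
  have hI : volume.real (ball w (1 / 4)) * (‖x‖ ^ 2 * (1 / 16)) ≤
      ∫ y in ball (0 : EuclideanSpace ℝ (Fin N)) 1, ⟪x, y⟫ ^ 2 := by
    calc volume.real (ball w (1 / 4)) * (‖x‖ ^ 2 * (1 / 16))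
        = ∫ _ in ball w (1 / 4), ‖x‖ ^ 2 * (1 / 16) := by
          rw [setIntegral_const, smul_eq_mul]
      _ ≤ ∫ y in ball w (1 / 4), ⟪x, y⟫ ^ 2 :=
          setIntegral_mono_on (integrableOn_const measure_ball_lt_top.ne)
            (hinteg.mono_set hsub) measurableSet_ball hlow
      _ ≤ _ := setIntegral_mono_set hinteg (Filter.Eventually.of_forall fun y => sq_nonneg _)
          hsub.eventuallyLE
  rw [setAverage_eq, smul_eq_mul, inv_mul_eq_div, le_div_iff₀ hpos]
  rw [hvol] at hI
  linarith

theorem two_add_half_sq_le_exp_add_exp_neg (t : ℝ) :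
    2 + t ^ 2 / 2 ≤ Real.exp t + Real.exp (-t) := by
  rcases le_total 0 t with h | h
  · linarith [Real.quadratic_le_exp_of_nonneg h, Real.add_one_le_exp (-t)]
  · have := Real.quadratic_le_exp_of_nonneg (neg_nonneg.2 h)
    rw [neg_sq] at this
    linarith [Real.add_one_le_exp t]

theorem le_ddiff_gaussian {N : ℕ} {γ : ℝ} (x h : EuclideanSpace ℝ (Fin N))
    (hh : γ * ‖h‖ ^ 2 ≤ 1 / 2) :
    Real.exp (-γ * ‖x‖ ^ 2) * (γ ^ 2 * ⟪x, h⟫ ^ 2 - 2 * γ * ‖h‖ ^ 2) ≤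
      ddiff (fun z => Real.exp (-γ * ‖z‖ ^ 2)) x h := by
  set t : ℝ := 2 * γ * ⟪x, h⟫ with ht
  have h1 : ddiff (fun z => Real.exp (-γ * ‖z‖ ^ 2)) x h =
      Real.exp (-γ * ‖x‖ ^ 2) *
        (Real.exp (-(γ * ‖h‖ ^ 2)) * (Real.exp t + Real.exp (-t)) - 2) := by
    simp only [ddiff, norm_add_sq_real, norm_sub_sq_real, mul_sub, mul_add, ← Real.exp_add]
    rw [ht]
    ring_nf
  rw [h1]
  refine mul_le_mul_of_nonneg_left ?_ (Real.exp_nonneg _)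
  have h2 : 1 - γ * ‖h‖ ^ 2 ≤ Real.exp (-(γ * ‖h‖ ^ 2)) := by
    linarith [Real.add_one_le_exp (-(γ * ‖h‖ ^ 2))]
  have h3 := two_add_half_sq_le_exp_add_exp_neg t
  have h4 : (1 - γ * ‖h‖ ^ 2) * (2 + t ^ 2 / 2) ≤
      Real.exp (-(γ * ‖h‖ ^ 2)) * (Real.exp t + Real.exp (-t)) := by
    apply mul_le_mul h2 h3 (by positivity) (Real.exp_nonneg _)
  have h5 : γ ^ 2 * ⟪x, h⟫ ^ 2 = t ^ 2 / 4 := by rw [ht]; ring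
  rw [h5]
  nlinarith [mul_nonneg (sq_nonneg t) (sub_nonneg.2 hh)]

/-- A Gaussian bump, vanishing on the sphere of radius `7/2`, minus a paraboloid of vertex `y`. -/
noncomputable def testFun {N : ℕ} (γ A : ℝ) (y x : EuclideanSpace ℝ (Fin N)) : ℝ :=
  A * (Real.exp (-γ * ‖x‖ ^ 2) - Real.exp (-γ * (49 / 4))) - ‖x - y‖ ^ 2

theorem le_ddiff_testFun {N : ℕ} {γ A : ℝ} (hA : 0 ≤ A)
    (y x h : EuclideanSpace ℝ (Fin N)) (hh : γ * ‖h‖ ^ 2 ≤ 1 / 2) :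
    A * Real.exp (-γ * ‖x‖ ^ 2) * γ ^ 2 * ⟪x, h⟫ ^ 2 -
        (2 * (A * Real.exp (-γ * ‖x‖ ^ 2)) * γ + 2) * ‖h‖ ^ 2 ≤ ddiff (testFun γ A y) x h := by
  have h1 := mul_le_mul_of_nonneg_left (le_ddiff_gaussian x h hh) hA
  have h2 : ddiff (testFun γ A y) x h =
      A * ddiff (fun z => Real.exp (-γ * ‖z‖ ^ 2)) x h - 2 * ‖h‖ ^ 2 := by
    have e1 : x + h - y = (x - y) + h := by abel
    have e2 : x - h - y = (x - y) - h := by abel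
    simp only [ddiff, testFun, e1, e2]
    rw [norm_add_sq_real (x - y) h, norm_sub_sq_real (x - y) h]
    ring
  rw [h2]
  linarith

theorem integrableOn_ddiff {N : ℕ} {U : EuclideanSpace ℝ (Fin N) → ℝ} (hU : Measurable U)
    (hb : ∃ K, ∀ x, |U x| ≤ K) (x : EuclideanSpace ℝ (Fin N)) (ε : ℝ) :
    IntegrableOn (fun y => ddiff U x (ε • y)) (ball (0 : EuclideanSpace ℝ (Fin N)) 1) volume := by
  obtain ⟨K, hK⟩ := hb
  refine Measure.integrableOn_of_bounded (M := 4 * K) measure_ball_lt_top.ne ?_ ?_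
  · unfold ddiff
    fun_prop
  · refine Filter.Eventually.of_forall fun y => ?_
    rw [Real.norm_eq_abs, abs_le]
    have h1 := abs_le.1 (hK (x + ε • y))
    have h2 := abs_le.1 (hK (x - ε • y))
    have h3 := abs_le.1 (hK x)
    unfold ddiff
    constructor <;> linarith

theorem setAverage_mono_on {N : ℕ} {f g : EuclideanSpace ℝ (Fin N) → ℝ}
    {s : Set (EuclideanSpace ℝ (Fin N))} (hs : MeasurableSet s) (hf : IntegrableOn f s volume)
    (hg : IntegrableOn g s volume) (h : ∀ x ∈ s, f x ≤ g x) : ⨍ x in s, f x ≤ ⨍ x in s, g x := by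
  rw [setAverage_eq, setAverage_eq]
  exact smul_le_smul_of_nonneg_left (setIntegral_mono_on hf hg hs h) (by positivity)

theorem le_setAverage_ddiff {N : ℕ} {c ε P Q τ : ℝ} (hP : 0 ≤ P) (hQ : 0 ≤ Q)
    (hc : ∀ x : EuclideanSpace ℝ (Fin N),
      c * ‖x‖ ^ 2 ≤ ⨍ y in ball (0 : EuclideanSpace ℝ (Fin N)) 1, ⟪x, y⟫ ^ 2)
    {U : EuclideanSpace ℝ (Fin N) → ℝ} (hU : Measurable U) (hb : ∃ K, ∀ x, |U x| ≤ K)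
    (hε : 0 < ε) {x : EuclideanSpace ℝ (Fin N)}
    (h : ∀ h, ‖h‖ < ε → P * ⟪x, h⟫ ^ 2 - Q * ‖h‖ ^ 2 - τ * ε ^ 2 ≤ ddiff U x h) :
    ε ^ 2 * (P * c * ‖x‖ ^ 2 - Q - τ) ≤
      ⨍ y in ball (0 : EuclideanSpace ℝ (Fin N)) 1, ddiff U x (ε • y) := by
  have hinteg : IntegrableOn (fun y => ⟪x, y⟫ ^ 2) (ball (0 : EuclideanSpace ℝ (Fin N)) 1) volume :=
    ((by fun_prop : Continuous fun y => ⟪x, y⟫ ^ 2).continuousOn.integrableOn_compact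
      (isCompact_closedBall (0 : EuclideanSpace ℝ (Fin N)) 1)).mono_set ball_subset_closedBall
  have hcst : IntegrableOn (fun _ => ε ^ 2 * (Q + τ))
      (ball (0 : EuclideanSpace ℝ (Fin N)) 1) volume := integrableOn_const measure_ball_lt_top.ne
  have hpos : 0 < volume.real (ball (0 : EuclideanSpace ℝ (Fin N)) 1) :=
    ENNReal.toReal_pos (measure_ball_pos _ _ one_pos).ne' measure_ball_lt_top.ne
  have havg : ⨍ y in ball (0 : EuclideanSpace ℝ (Fin N)) 1,
      (ε ^ 2 * P * ⟪x, y⟫ ^ 2 - ε ^ 2 * (Q + τ)) =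
      ε ^ 2 * P * (⨍ y in ball (0 : EuclideanSpace ℝ (Fin N)) 1, ⟪x, y⟫ ^ 2)
        - ε ^ 2 * (Q + τ) := by
    rw [setAverage_eq, setAverage_eq, integral_sub (hinteg.const_mul _) hcst, integral_const_mul,
      setIntegral_const]
    simp only [smul_eq_mul]
    field_simp
  have hinteg' : IntegrableOn (fun y => ε ^ 2 * P * ⟪x, y⟫ ^ 2 - ε ^ 2 * (Q + τ))
      (ball (0 : EuclideanSpace ℝ (Fin N)) 1) volume := (hinteg.const_mul _).sub hcst
  refine le_trans ?_ (setAverage_mono_on (f := fun y => ε ^ 2 * P * ⟪x, y⟫ ^ 2 - ε ^ 2 * (Q + τ))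
    measurableSet_ball hinteg' (integrableOn_ddiff hU hb x ε) ?_)
  · rw [havg]
    have := mul_le_mul_of_nonneg_left (hc x) (by positivity : 0 ≤ ε ^ 2 * P)
    linarith
  · intro y hy
    have hy1 : ‖y‖ < 1 := mem_ball_zero_iff.1 hy
    have hn : ‖ε • y‖ = ε * ‖y‖ := by rw [norm_smul, Real.norm_of_nonneg hε.le]
    have h1 := h (ε • y) (by rw [hn]; nlinarith)
    rw [hn, real_inner_smul_right] at h1
    refine le_trans ?_ h1
    have : ‖y‖ ^ 2 ≤ 1 := by nlinarith [norm_nonneg y]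
    nlinarith [mul_nonneg (mul_nonneg hQ (sq_nonneg ε)) (sub_nonneg.2 this)]

/-- The averaging part of `Lminus` is controlled by a lower bound on the second differences. -/
theorem mul_setAverage_ddiff_le {N : ℕ} {Λ α β ε σ ρ : ℝ} (hα : 0 ≤ α) (hΛ : 0 < Λ)
    {U : EuclideanSpace ℝ (Fin N) → ℝ} (hε : 0 < ε) {x : EuclideanSpace ℝ (Fin N)}
    (h : ∀ h, ‖h‖ < ε * Λ → -(σ * ε ^ 2) ≤ ddiff U x h) (hL : Lminus Λ α β ε U x ≤ ρ) :
    β * (⨍ y in ball (0 : EuclideanSpace ℝ (Fin N)) 1, ddiff U x (ε • y)) ≤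
      ε ^ 2 * (2 * ρ + α * σ) := by
  have h1 : -(σ * ε ^ 2) ≤
      sInf ((fun z => ddiff U x (ε • z)) '' ball (0 : EuclideanSpace ℝ (Fin N)) Λ) := by
    refine le_csInf ((nonempty_ball.2 hΛ).image _) ?_
    rintro _ ⟨z, hz, rfl⟩
    refine h _ ?_
    rw [norm_smul, Real.norm_of_nonneg hε.le]
    exact mul_lt_mul_of_pos_left (mem_ball_zero_iff.1 hz) hε
  have h2 := mul_le_mul_of_nonneg_left h1 hα
  rw [Lminus, one_div, inv_mul_le_iff₀ (by positivity)] at hL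
  linarith

/-- Constants of the barrier. -/
theorem exists_barrier_constants {Λ β c : ℝ} (hΛ : 1 ≤ Λ) (hβ : 0 < β) (hc : 0 < c) :
    ∃ γ A : ℝ, 0 < γ ∧ 0 < A ∧ 15 ≤ A * (Real.exp (-γ * 9) - Real.exp (-γ * (49 / 4))) ∧
      ∀ s : ℝ, 1 / 2 ≤ s → s ≤ 7 / 2 →
        4 + (2 * (A * Real.exp (-γ * s ^ 2)) * γ + 2) * Λ ^ 2 <
          β * (A * Real.exp (-γ * s ^ 2) * γ ^ 2 * c * s ^ 2) := by
  have hΛ0 : 0 < Λ := by linarith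
  set γ : ℝ := 16 * Λ ^ 2 / (β * c) with hγ
  have hγ0 : 0 < γ := by positivity
  have hd : 0 < Real.exp (-γ * 9) - Real.exp (-γ * (49 / 4)) :=
    sub_pos.2 (Real.exp_lt_exp.2 (by linarith))
  have he := Real.exp_pos (γ * (49 / 4))
  refine ⟨γ, 4 * Real.exp (γ * (49 / 4)) / γ +
    15 / (Real.exp (-γ * 9) - Real.exp (-γ * (49 / 4))), hγ0, by positivity, ?_, ?_⟩
  · rw [add_mul, div_mul_cancel₀ _ hd.ne']
    have : 0 ≤ 4 * Real.exp (γ * (49 / 4)) / γ := by positivity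
    nlinarith
  · intro s hs1 hs2
    set A : ℝ := 4 * Real.exp (γ * (49 / 4)) / γ +
      15 / (Real.exp (-γ * 9) - Real.exp (-γ * (49 / 4))) with hA
    have hA1 : 4 * Real.exp (γ * (49 / 4)) / γ ≤ A := by
      rw [hA]; have := div_nonneg (by norm_num : (0 : ℝ) ≤ 15) hd.le; linarith
    have h1 : Real.exp (-(γ * (49 / 4))) ≤ Real.exp (-γ * s ^ 2) := by
      have : s ^ 2 ≤ 49 / 4 := by nlinarith
      apply Real.exp_le_exp.2
      nlinarith [mul_le_mul_of_nonneg_left this hγ0.le]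
    have h2 : 4 ≤ A * Real.exp (-γ * s ^ 2) * γ := by
      calc 4 = 4 * Real.exp (γ * (49 / 4)) / γ * Real.exp (-(γ * (49 / 4))) * γ := by
            rw [Real.exp_neg]; field_simp
        _ ≤ _ := by gcongr
    set B := A * Real.exp (-γ * s ^ 2) * γ with hB
    have e1 : 2 * (A * Real.exp (-γ * s ^ 2)) * γ = 2 * B := by rw [hB]; ring
    have e2 : β * (A * Real.exp (-γ * s ^ 2) * γ ^ 2 * c * s ^ 2) = B * (16 * Λ ^ 2) * s ^ 2 := by
      have : β * c * γ = 16 * Λ ^ 2 := by rw [hγ]; field_simp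
      rw [← this, hB]; ring
    rw [e1, e2]
    have h3 : (1 : ℝ) / 4 ≤ s ^ 2 := by nlinarith
    have h4 : 1 ≤ Λ ^ 2 := by nlinarith
    have h5 : B * (16 * Λ ^ 2) * (1 / 4) ≤ B * (16 * Λ ^ 2) * s ^ 2 := by gcongr
    nlinarith

/-- A function bounded below admits approximate minimizers. -/
theorem exists_approx_min {X : Type*} {s : Set X} (hs : s.Nonempty) {f : X → ℝ} {b τ : ℝ}
    (hb : ∀ x ∈ s, b ≤ f x) (hτ : 0 < τ) : ∃ x ∈ s, ∀ z ∈ s, f x ≤ f z + τ := by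
  obtain ⟨_, ⟨x, hx, rfl⟩, h⟩ := Real.lt_sInf_add_pos (hs.image f) hτ
  refine ⟨x, hx, fun z hz => ?_⟩
  have : sInf (f '' s) ≤ f z := csInf_le ⟨b, by rintro _ ⟨w, hw, rfl⟩; exact hb w hw⟩ ⟨z, hz, rfl⟩
  linarith

theorem volume_add_smul_image {N : ℕ} (x : EuclideanSpace ℝ (Fin N)) {ε : ℝ} (hε : 0 ≤ ε)
    (s : Set (EuclideanSpace ℝ (Fin N))) :
    volume ((fun y => x + ε • y) '' s) = ENNReal.ofReal (ε ^ N) * volume s := by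
  have : (fun y => x + ε • y) '' s = (fun z => x + z) '' (ε • s) := by
    rw [← Set.image_smul, Set.image_image]
  rw [this, Set.image_add_left, measure_preimage_add, Measure.addHaar_smul,
    finrank_euclideanSpace_fin, abs_of_nonneg (by positivity)]

/-- Markov's inequality for the second differences at scale `ε`. -/
theorem volume_image_large_ddiff_le {N : ℕ} {ε κ C η : ℝ} (hε : 0 < ε) (hC : 0 < C) (hη : 0 < η)
    {U : EuclideanSpace ℝ (Fin N) → ℝ} (hU : Measurable U) (hb : ∃ K, ∀ x, |U x| ≤ K)
    {x : EuclideanSpace ℝ (Fin N)}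
    (hnonneg : ∀ h : EuclideanSpace ℝ (Fin N), ‖h‖ < 1 → 0 ≤ ddiff U x (ε • h) + κ * ε ^ 2)
    (havg : ⨍ y in ball (0 : EuclideanSpace ℝ (Fin N)) 1, ddiff U x (ε • y) ≤
      (C - κ) * ε ^ 2) :
    volume ((fun h => x + ε • h) '' {h ∈ ball (0 : EuclideanSpace ℝ (Fin N)) 1 |
      C / η * ε ^ 2 ≤ ddiff U x (ε • h) + κ * ε ^ 2}) ≤ ENNReal.ofReal η * volume (ball x ε) := by
  set S : Set (EuclideanSpace ℝ (Fin N)) :=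
    {h ∈ ball 0 1 | C / η * ε ^ 2 ≤ ddiff U x (ε • h) + κ * ε ^ 2} with hS
  set a := ⨍ y in ball (0 : EuclideanSpace ℝ (Fin N)) 1, ddiff U x (ε • y) with ha
  have hinteg : IntegrableOn (fun h => ddiff U x (ε • h) + κ * ε ^ 2)
      (ball (0 : EuclideanSpace ℝ (Fin N)) 1) volume :=
    (integrableOn_ddiff hU hb x ε).add (integrableOn_const measure_ball_lt_top.ne)
  have hpos : 0 < volume.real (ball (0 : EuclideanSpace ℝ (Fin N)) 1) :=
    ENNReal.toReal_pos (measure_ball_pos _ _ one_pos).ne' measure_ball_lt_top.ne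
  have hI : ∫ h in ball (0 : EuclideanSpace ℝ (Fin N)) 1, (ddiff U x (ε • h) + κ * ε ^ 2) ≤
      C * ε ^ 2 * volume.real (ball (0 : EuclideanSpace ℝ (Fin N)) 1) := by
    rw [integral_add (integrableOn_ddiff hU hb x ε) (integrableOn_const measure_ball_lt_top.ne),
      setIntegral_const, smul_eq_mul]
    have h1 : ∫ h in ball (0 : EuclideanSpace ℝ (Fin N)) 1, ddiff U x (ε • h) =
        a * volume.real (ball (0 : EuclideanSpace ℝ (Fin N)) 1) := by
      rw [ha, setAverage_eq, smul_eq_mul]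
      field_simp
    rw [h1]
    have := mul_le_mul_of_nonneg_right havg hpos.le
    linarith
  have hmarkov := mul_meas_ge_le_integral_of_nonneg
    (μ := volume.restrict (ball (0 : EuclideanSpace ℝ (Fin N)) 1)) ?_ hinteg (C / η * ε ^ 2)
  · have hSm : volume.real S ≤ η * volume.real (ball (0 : EuclideanSpace ℝ (Fin N)) 1) := by
      have h1 : volume.real S = (volume.restrict (ball (0 : EuclideanSpace ℝ (Fin N)) 1)).real
          {h | C / η * ε ^ 2 ≤ ddiff U x (ε • h) + κ * ε ^ 2} := by
        rw [measureReal_restrict_apply' measurableSet_ball, Set.inter_comm]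
        rfl
      rw [← h1] at hmarkov
      have h2 := mul_le_mul_of_nonneg_left (hmarkov.trans hI) hη.le
      have h4 : η * (C / η * ε ^ 2 * volume.real S) = C * ε ^ 2 * volume.real S := by field_simp
      have h3 : 0 < C * ε ^ 2 := by positivity
      refine le_of_mul_le_mul_left ?_ h3
      linarith
    have hSfin : volume S ≠ ⊤ :=
      ((measure_mono (Set.sep_subset _ _)).trans_lt measure_ball_lt_top).ne
    calc _ = ENNReal.ofReal (ε ^ N) * volume S := volume_add_smul_image x hε.le S
      _ ≤ ENNReal.ofReal (ε ^ N) * (ENNReal.ofReal η *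
            volume (ball (0 : EuclideanSpace ℝ (Fin N)) 1)) := by
          gcongr
          rw [← ENNReal.ofReal_toReal hSfin,
            ← ENNReal.ofReal_toReal (measure_ball_lt_top (μ := volume)
              (x := (0 : EuclideanSpace ℝ (Fin N))) (r := 1)).ne, ← ENNReal.ofReal_mul hη.le]
          exact ENNReal.ofReal_le_ofReal hSm
      _ = _ := by
          rw [Measure.addHaar_ball_of_pos _ _ hε, finrank_euclideanSpace_fin]
          ring
  · rw [Filter.EventuallyLE, ae_restrict_iff' measurableSet_ball]
    exact Filter.Eventually.of_forall fun h hh => hnonneg h (mem_ball_zero_iff.1 hh)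

theorem testFun_le {N : ℕ} {γ A : ℝ} (hγ : 0 ≤ γ) (hA : 0 ≤ A)
    (y z : EuclideanSpace ℝ (Fin N)) : testFun γ A y z ≤ A := by
  have h1 : Real.exp (-γ * ‖z‖ ^ 2) ≤ 1 :=
    Real.exp_le_one_iff.2 (by nlinarith [mul_nonneg hγ (sq_nonneg ‖z‖)])
  have h2 := Real.exp_pos (-γ * (49 / 4))
  have h3 : A * (Real.exp (-γ * ‖z‖ ^ 2) - Real.exp (-γ * (49 / 4))) ≤ A * 1 := by
    gcongr
    linarith
  unfold testFun
  linarith [sq_nonneg ‖z - y‖]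

theorem testFun_nonpos {N : ℕ} {γ A : ℝ} (hγ : 0 ≤ γ) (hA : 0 ≤ A)
    (y : EuclideanSpace ℝ (Fin N)) {z : EuclideanSpace ℝ (Fin N)} (hz : 7 / 2 ≤ ‖z‖) :
    testFun γ A y z ≤ 0 := by
  have h0 : (49 : ℝ) / 4 ≤ ‖z‖ ^ 2 := by nlinarith
  have h1 : Real.exp (-γ * ‖z‖ ^ 2) ≤ Real.exp (-γ * (49 / 4)) :=
    Real.exp_le_exp.2 (by nlinarith [mul_le_mul_of_nonneg_left h0 hγ])
  have h2 := mul_le_mul_of_nonneg_left h1 hA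
  unfold testFun
  linarith [sq_nonneg ‖z - y‖]

theorem le_testFun {N : ℕ} {γ A : ℝ} (hγ : 0 ≤ γ) (hA : 0 ≤ A)
    (hA15 : 15 ≤ A * (Real.exp (-γ * 9) - Real.exp (-γ * (49 / 4))))
    {y z : EuclideanSpace ℝ (Fin N)} (hy : ‖y‖ < 1 / 2) (hz : ‖z‖ < 3) :
    11 / 4 ≤ testFun γ A y z := by
  have h0 : ‖z‖ ^ 2 ≤ 9 := by nlinarith [norm_nonneg z]
  have h2 : Real.exp (-γ * 9) ≤ Real.exp (-γ * ‖z‖ ^ 2) :=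
    Real.exp_le_exp.2 (by nlinarith [mul_le_mul_of_nonneg_left h0 hγ])
  have h3 : ‖z - y‖ ≤ 7 / 2 := (norm_sub_le _ _).trans (by linarith)
  have h4 : ‖z - y‖ ^ 2 ≤ 49 / 4 := by nlinarith [norm_nonneg (z - y)]
  have h5 := mul_le_mul_of_nonneg_left h2 hA
  unfold testFun
  linarith

set_option maxHeartbeats 1000000 in
/-- **Contact points.** Sliding a test function from below a nonnegative supersolution that is
small somewhere, one touches it in the ball of radius `1/2`, and near the contact point the
supersolution exceeds the test function by at most `O(ε²)` on most of the ball of radius `ε`. -/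
theorem exists_contact_point (N : ℕ) {Λ α β η : ℝ} (hΛ : 1 ≤ Λ) (hβ : 0 < β) (hα : 0 ≤ α)
    (hαβ : α + β = 1) (hη : 0 < η) :
    ∃ γ A C ε₁ : ℝ, 0 < γ ∧ 0 < A ∧ 0 < C ∧ 0 < ε₁ ∧ ∀ ε : ℝ, 0 < ε → ε < ε₁ →
      ∀ U : EuclideanSpace ℝ (Fin N) → ℝ, Measurable U → (∃ K, ∀ x, |U x| ≤ K) →
        (∀ x ∈ ball (0 : EuclideanSpace ℝ (Fin N)) 4, 0 ≤ U x) →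
        (∀ x ∈ ball (0 : EuclideanSpace ℝ (Fin N)) 4, Lminus Λ α β ε U x ≤ 1) →
        (∃ x ∈ ball (0 : EuclideanSpace ℝ (Fin N)) 3, U x ≤ 1) →
        ∀ y ∈ ball (0 : EuclideanSpace ℝ (Fin N)) (1 / 2),
          ∃ x ∈ ball (0 : EuclideanSpace ℝ (Fin N)) (1 / 2), ∃ m ≤ (0 : ℝ),
            (∀ z ∈ ball (0 : EuclideanSpace ℝ (Fin N)) 4, testFun γ A y z + m ≤ U z) ∧
            volume {z ∈ ball x ε | testFun γ A y z + m + C * ε ^ 2 < U z} ≤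
              ENNReal.ofReal η * volume (ball x ε) := by
  obtain ⟨c, hc, hmom⟩ := exists_second_moment_lower_bound N
  obtain ⟨γ, A, hγ, hA, hA15, hbar⟩ := exists_barrier_constants hΛ hβ hc
  set Qm : ℝ := 2 * A * γ + 2 with hQm
  have hQm0 : 0 < Qm := by positivity
  set C₁ : ℝ := (4 + Qm * Λ ^ 2) / β + Qm + 2 with hC₁
  have hC₁0 : 0 < C₁ := by positivity
  have hΛ0 : 0 < Λ := by linarith
  refine ⟨γ, A, C₁ / η, min (1 / (2 * Λ)) (1 / (2 * (γ + 1) * Λ)), hγ, hA, by positivity,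
    by positivity, ?_⟩
  intro ε hε hεlt U hU hb hU0 hL ⟨x₁, hx₁, hUx₁⟩ y hy
  have hεΛ : ε * Λ < 1 / 2 := by
    have := lt_of_lt_of_le hεlt (min_le_left _ _)
    rw [lt_div_iff₀ (by positivity)] at this
    linarith
  have hεγ : (γ + 1) * (ε * Λ) < 1 / 2 := by
    have := lt_of_lt_of_le hεlt (min_le_right _ _)
    rw [lt_div_iff₀ (by positivity)] at this
    linarith
  have hε1 : ε < 1 / 2 := by nlinarith
  have hγh : ∀ h : EuclideanSpace ℝ (Fin N), ‖h‖ < ε * Λ → γ * ‖h‖ ^ 2 ≤ 1 / 2 := by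
    intro h hh
    have h1 : ‖h‖ ^ 2 ≤ ε * Λ := by nlinarith [norm_nonneg h]
    nlinarith [mul_le_mul_of_nonneg_left h1 hγ.le]
  have hy2 : ‖y‖ < 1 / 2 := mem_ball_zero_iff.1 hy
  set f : EuclideanSpace ℝ (Fin N) → ℝ := fun z => U z - testFun γ A y z with hf
  obtain ⟨x, hx4, hmin⟩ := exists_approx_min (s := ball (0 : EuclideanSpace ℝ (Fin N)) 4) (f := f)
    (nonempty_ball.2 (by norm_num)) (b := -A) (τ := ε ^ 2)
    (fun z hz => by have := hU0 z hz; have := testFun_le hγ.le hA.le y z; simp only [hf]; linarith)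
    (by positivity)
  have hfx : f x < -1 := by
    have h1 := hmin x₁ (ball_subset_ball (by norm_num) hx₁)
    have h2 := le_testFun hγ.le hA.le hA15 hy2 (mem_ball_zero_iff.1 hx₁)
    have h3 : f x₁ ≤ -(7 / 4) := by simp only [hf]; linarith
    have h4 : ε ^ 2 ≤ 1 / 4 := by nlinarith
    linarith
  have hx72 : ‖x‖ < 7 / 2 := by
    by_contra! hcon
    have h2 := hU0 x hx4
    have h3 := testFun_nonpos hγ.le hA.le y hcon
    simp only [hf] at hfx
    linarith
  have hball : ∀ h : EuclideanSpace ℝ (Fin N), ‖h‖ < 1 / 2 →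
      x + h ∈ ball (0 : EuclideanSpace ℝ (Fin N)) 4 := fun h hh =>
    mem_ball_zero_iff.2 ((norm_add_le _ _).trans_lt (by linarith))
  have hball' : ∀ h : EuclideanSpace ℝ (Fin N), ‖h‖ < 1 / 2 →
      x - h ∈ ball (0 : EuclideanSpace ℝ (Fin N)) 4 := fun h hh =>
    mem_ball_zero_iff.2 ((norm_sub_le _ _).trans_lt (by linarith))
  set P : ℝ := A * Real.exp (-γ * ‖x‖ ^ 2) * γ ^ 2 with hP
  set Q : ℝ := 2 * (A * Real.exp (-γ * ‖x‖ ^ 2)) * γ + 2 with hQ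
  have hP0 : 0 ≤ P := by positivity
  have hQ0 : 0 ≤ Q := by positivity
  have hQQm : Q ≤ Qm := by
    have h1 : Real.exp (-γ * ‖x‖ ^ 2) ≤ 1 := Real.exp_le_one_iff.2 (by nlinarith [sq_nonneg ‖x‖])
    have : A * Real.exp (-γ * ‖x‖ ^ 2) ≤ A * 1 := by gcongr
    rw [hQ, hQm]
    nlinarith
  have hdiff : ∀ h, ‖h‖ < ε * Λ → P * ⟪x, h⟫ ^ 2 - Q * ‖h‖ ^ 2 - 2 * ε ^ 2 ≤ ddiff U x h := by
    intro h hh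
    have h1 := le_ddiff_testFun hA.le y x h (hγh h hh)
    have h2 := hmin _ (hball h (hh.trans hεΛ))
    have h3 := hmin _ (hball' h (hh.trans hεΛ))
    simp only [ddiff, hf] at *
    linarith
  have hεε : ε ≤ ε * Λ := le_mul_of_one_le_right hε.le hΛ
  set a := ⨍ y in ball (0 : EuclideanSpace ℝ (Fin N)) 1, ddiff U x (ε • y) with ha
  have hlow : ε ^ 2 * (P * c * ‖x‖ ^ 2 - Q - 2) ≤ a :=
    le_setAverage_ddiff hP0 hQ0 hmom hU hb hε fun h hh => hdiff h (hh.trans_le hεε)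
  have hup : β * a ≤ ε ^ 2 * (2 * 1 + α * (Q * Λ ^ 2 + 2)) := by
    refine mul_setAverage_ddiff_le hα hΛ0 hε (fun h hh => ?_) (hL x hx4)
    have h1 := hdiff h hh
    have h2 : ‖h‖ ^ 2 ≤ (ε * Λ) ^ 2 := by gcongr
    have h3 := mul_le_mul_of_nonneg_left h2 hQ0
    have h4 := mul_nonneg hP0 (sq_nonneg ⟪x, h⟫)
    linarith
  have hα1 : α ≤ 1 := by linarith
  have hε2 : 0 < ε ^ 2 := by positivity
  have hΛ2 : 1 ≤ Λ ^ 2 := one_le_pow₀ hΛ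
  have hx12 : ‖x‖ < 1 / 2 := by
    by_contra! hcon
    have h1 : 4 + Q * Λ ^ 2 < β * (P * c * ‖x‖ ^ 2) := hbar ‖x‖ hcon hx72.le
    have h2 := (mul_le_mul_of_nonneg_left hlow hβ.le).trans hup
    have h3 : β * (P * c * ‖x‖ ^ 2 - Q - 2) ≤ 2 * 1 + α * (Q * Λ ^ 2 + 2) := by
      refine le_of_mul_le_mul_left ?_ hε2
      linarith
    have h4 : β * Q ≤ β * (Q * Λ ^ 2) := by
      gcongr
      exact le_mul_of_one_le_right hQ0 hΛ2
    have h5 : α * (Q * Λ ^ 2) + β * (Q * Λ ^ 2) = Q * Λ ^ 2 := by rw [← add_mul, hαβ, one_mul]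
    linarith
  refine ⟨x, mem_ball_zero_iff.2 hx12, f x - ε ^ 2, by linarith, ?_, ?_⟩
  · intro z hz
    have := hmin z hz
    simp only [hf] at *
    linarith
  have ha' : a ≤ ε ^ 2 * ((4 + Qm * Λ ^ 2) / β) := by
    rw [← mul_div_assoc, le_div_iff₀ hβ, mul_comm]
    refine hup.trans ?_
    have : Q * Λ ^ 2 ≤ Qm * Λ ^ 2 := by gcongr
    have : α * (Q * Λ ^ 2 + 2) ≤ 1 * (Q * Λ ^ 2 + 2) := by gcongr
    refine mul_le_mul_of_nonneg_left ?_ hε2.le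
    linarith
  have hnonneg : ∀ h : EuclideanSpace ℝ (Fin N), ‖h‖ < 1 →
      0 ≤ ddiff U x (ε • h) + (Qm + 2) * ε ^ 2 := by
    intro h hh1
    have hn : ‖ε • h‖ < ε := by
      rw [norm_smul, Real.norm_of_nonneg hε.le]
      exact mul_lt_of_lt_one_right hε hh1
    have h1 := hdiff (ε • h) (hn.trans_le hεε)
    have h4 : Q * ‖ε • h‖ ^ 2 ≤ Qm * ε ^ 2 := by gcongr
    have h5 := mul_nonneg hP0 (sq_nonneg ⟪x, ε • h⟫)
    linarith
  have hvol := volume_image_large_ddiff_le hε hC₁0 hη hU hb hnonneg (by linarith)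
  refine (measure_mono ?_).trans hvol
  rintro z ⟨hz, hzU⟩
  have hz' : ‖z - x‖ < ε := mem_ball_iff_norm.1 hz
  have hzε : ε • (ε⁻¹ • (z - x)) = z - x := by rw [smul_smul, mul_inv_cancel₀ hε.ne', one_smul]
  refine ⟨ε⁻¹ • (z - x), ⟨?_, ?_⟩, by simp [hzε]⟩
  · rw [mem_ball_zero_iff, norm_smul, norm_inv, Real.norm_of_nonneg hε.le,
      inv_mul_lt_iff₀ hε, mul_one]
    exact hz'
  · rw [hzε]
    have h0 : ‖z - x‖ < ε * Λ := hz'.trans_le hεε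
    have h1 := le_ddiff_testFun hA.le y x (z - x) (hγh _ h0)
    have h3 := hmin _ (hball' (z - x) (by linarith))
    have h4 : Q * ‖z - x‖ ^ 2 ≤ Qm * ε ^ 2 := by gcongr
    have h5 := mul_nonneg hP0 (sq_nonneg ⟪x, z - x⟫)
    have h6 : x + (z - x) = z := by abel
    simp only [ddiff, hf, h6] at *
    linarith

theorem exists_mem_small_ball_notMem {N : ℕ} {ε : ℝ} (hε : 0 < ε)
    {x x' w : EuclideanSpace ℝ (Fin N)} {s s' : Set (EuclideanSpace ℝ (Fin N))}
    (hs : volume s ≤ ENNReal.ofReal ((1 / 40) ^ N / 4) * volume (ball x ε))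
    (hs' : volume s' ≤ ENNReal.ofReal ((1 / 40) ^ N / 4) * volume (ball x' ε)) :
    ∃ z ∈ ball w (ε / 40), z ∉ s ∧ z ∉ s' := by
  by_contra! hcon
  have hsub : ball w (ε / 40) ⊆ s ∪ s' := fun z hz => by
    by_cases h : z ∈ s
    · exact Or.inl h
    · exact Or.inr (hcon z hz h)
  have h1 := (measure_mono hsub).trans ((measure_union_le s s').trans (add_le_add hs hs'))
  have hpos : 0 < volume (ball (0 : EuclideanSpace ℝ (Fin N)) 1) := measure_ball_pos _ _ one_pos
  rw [Measure.addHaar_ball_of_pos _ _ hε, Measure.addHaar_ball_of_pos _ _ hε,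
    Measure.addHaar_ball_of_pos _ _ (by positivity), finrank_euclideanSpace_fin, ← mul_assoc,
    ← add_mul, ← ENNReal.ofReal_mul (by positivity), ← ENNReal.ofReal_add (by positivity)
    (by positivity), ENNReal.mul_le_mul_iff_left hpos.ne' measure_ball_lt_top.ne,
    ENNReal.ofReal_le_ofReal_iff (by positivity)] at h1
  have h2 : (ε / 40) ^ N = (1 / 40) ^ N * ε ^ N := by rw [← mul_pow]; ring
  have h3 : 0 < (1 / 40 : ℝ) ^ N * ε ^ N := by positivity
  linarith

/-- Nearby contact points come from nearby vertices. -/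
theorem dist_vertices_le {N : ℕ} {γ A C ε m m' : ℝ} (hε : 0 < ε) (hε1 : ε < 1)
    {U : EuclideanSpace ℝ (Fin N) → ℝ} {x x' y y' : EuclideanSpace ℝ (Fin N)}
    (hx : x ∈ ball (0 : EuclideanSpace ℝ (Fin N)) (1 / 2)) (hxx' : dist x x' ≤ ε / 8)
    (hU : ∀ z ∈ ball (0 : EuclideanSpace ℝ (Fin N)) 4, testFun γ A y z + m ≤ U z)
    (hU' : ∀ z ∈ ball (0 : EuclideanSpace ℝ (Fin N)) 4, testFun γ A y' z + m' ≤ U z)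
    (hs : volume {z ∈ ball x ε | testFun γ A y z + m + C * ε ^ 2 < U z} ≤
      ENNReal.ofReal ((1 / 40) ^ N / 4) * volume (ball x ε))
    (hs' : volume {z ∈ ball x' ε | testFun γ A y' z + m' + C * ε ^ 2 < U z} ≤
      ENNReal.ofReal ((1 / 40) ^ N / 4) * volume (ball x' ε)) :
    0 < dist y y' → dist y y' ≤ 2 * C * ε := by
  intro hd
  rw [dist_eq_norm] at hd ⊢
  set e : EuclideanSpace ℝ (Fin N) := ‖y - y'‖⁻¹ • (y - y') with he
  have hen : ‖e‖ = 1 := by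
    rw [he, norm_smul, norm_inv, norm_norm, inv_mul_cancel₀ hd.ne']
  have key : ∀ σ : ℝ, |σ| = ε / 2 → ∃ z, ‖z - (x + σ • e)‖ < ε / 40 ∧
      |testFun γ A y z + m - (testFun γ A y' z + m')| ≤ C * ε ^ 2 := by
    intro σ hσ
    obtain ⟨z, hz, hz1, hz2⟩ := exists_mem_small_ball_notMem (w := x + σ • e) hε hs hs'
    have hzw : ‖z - (x + σ • e)‖ < ε / 40 := mem_ball_iff_norm.1 hz
    have hzx : ‖z - x‖ < ε * (21 / 40) := by
      calc ‖z - x‖ = ‖(z - (x + σ • e)) + σ • e‖ := by congr 1; abel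
        _ ≤ ‖z - (x + σ • e)‖ + ‖σ • e‖ := norm_add_le _ _
        _ < ε / 40 + ε / 2 := by
          rw [norm_smul, hen, Real.norm_eq_abs, hσ, mul_one]
          linarith
        _ = _ := by ring
    have hm1 : z ∈ ball x ε := mem_ball_iff_norm.2 (by linarith)
    have hm2 : z ∈ ball x' ε := by
      rw [mem_ball]
      rw [← dist_eq_norm] at hzx
      linarith [dist_triangle z x x']
    have hm4 : z ∈ ball (0 : EuclideanSpace ℝ (Fin N)) 4 := by
      rw [mem_ball_zero_iff] at hx ⊢
      calc ‖z‖ = ‖(z - x) + x‖ := by congr 1; abel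
        _ ≤ ‖z - x‖ + ‖x‖ := norm_add_le _ _
        _ < 4 := by linarith
    refine ⟨z, hzw, ?_⟩
    have g1 : U z ≤ testFun γ A y z + m + C * ε ^ 2 := by
      by_contra! h
      exact hz1 ⟨hm1, h⟩
    have g2 : U z ≤ testFun γ A y' z + m' + C * ε ^ 2 := by
      by_contra! h
      exact hz2 ⟨hm2, h⟩
    have g3 := hU z hm4
    have g4 := hU' z hm4
    rw [abs_le]
    constructor <;> linarith
  obtain ⟨z, hz, hzC⟩ := key (ε / 2) (abs_of_pos (by positivity))
  obtain ⟨z', hz', hzC'⟩ := key (-(ε / 2)) (by rw [abs_neg, abs_of_pos (by positivity)])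
  have hid : (testFun γ A y z + m - (testFun γ A y' z + m')) -
      (testFun γ A y z' + m - (testFun γ A y' z' + m')) = 2 * ⟪y - y', z - z'⟫ := by
    unfold testFun
    rw [norm_sub_sq_real, norm_sub_sq_real, norm_sub_sq_real, norm_sub_sq_real, inner_sub_left,
      inner_sub_right, inner_sub_right, real_inner_comm z y, real_inner_comm z y',
      real_inner_comm z' y, real_inner_comm z' y']
    ring
  set v := (z - (x + (ε / 2) • e)) - (z' - (x + (-(ε / 2)) • e)) with hv
  have hvn : ‖v‖ ≤ ε / 20 := (norm_sub_le _ _).trans (by linarith)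
  have hzz : z - z' = ε • e + v := by
    rw [hv]
    module
  have hin : ⟪y - y', ε • e⟫ = ε * ‖y - y'‖ := by
    rw [real_inner_smul_right, he, real_inner_smul_right, real_inner_self_eq_norm_sq]
    field_simp
  have h1 := (abs_le.1 (abs_real_inner_le_norm (y - y') v)).1
  have h2 : ‖y - y'‖ * ‖v‖ ≤ ‖y - y'‖ * (ε / 20) := by gcongr
  have h3 := abs_le.1 hzC
  have h4 := abs_le.1 hzC'
  rw [hzz, inner_add_right, hin] at hid
  have h5 : ε * ‖y - y'‖ ≤ ε * (2 * C * ε) := by nlinarith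
  exact le_of_mul_le_mul_left h5 hε

theorem volume_closedBall_inter_ge {N : ℕ} {ε : ℝ} (hε : 0 < ε)
    {x : EuclideanSpace ℝ (Fin N)} {s G : Set (EuclideanSpace ℝ (Fin N))}
    (hs : volume s ≤ ENNReal.ofReal ((1 / 40) ^ N / 4) * volume (ball x ε))
    (hG : closedBall x (ε / 40) ⊆ G ∪ s) :
    ENNReal.ofReal ((1 / 40) ^ N / 2 * ε ^ N) * volume (ball (0 : EuclideanSpace ℝ (Fin N)) 1) ≤
      volume (closedBall x (ε / 40) ∩ G) := by
  have h0 : closedBall x (ε / 40) ⊆ (closedBall x (ε / 40) ∩ G) ∪ s := fun z hz =>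
    (hG hz).imp (fun h => ⟨hz, h⟩) id
  have h1 := (measure_mono h0).trans ((measure_union_le _ s).trans (add_le_add le_rfl hs))
  rw [Measure.addHaar_closedBall _ _ (by positivity), Measure.addHaar_ball_of_pos _ _ hε,
    finrank_euclideanSpace_fin, ← mul_assoc, ← ENNReal.ofReal_mul (by positivity),
    ← tsub_le_iff_right, ← ENNReal.sub_mul (fun _ _ => measure_ball_lt_top.ne),
    ← ENNReal.ofReal_sub _ (by positivity)] at h1
  refine le_trans ?_ h1
  gcongr
  have h2 : (ε / 40) ^ N = (1 / 40) ^ N * ε ^ N := by rw [← mul_pow]; ring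
  have h3 : 0 < (1 / 40 : ℝ) ^ N * ε ^ N := by positivity
  linarith

/-- **Measure estimate at unit scale.** -/
theorem exists_measure_estimate_unit (N : ℕ) {Λ α β : ℝ} (hΛ : 1 ≤ Λ) (hβ : 0 < β) (hα : 0 ≤ α)
    (hαβ : α + β = 1) :
    ∃ M κ ε₁ : ℝ, 1 ≤ M ∧ 0 < κ ∧ 0 < ε₁ ∧ ∀ ε : ℝ, 0 < ε → ε < ε₁ →
      ∀ U : EuclideanSpace ℝ (Fin N) → ℝ, Measurable U → (∃ K, ∀ x, |U x| ≤ K) →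
        (∀ x ∈ ball (0 : EuclideanSpace ℝ (Fin N)) 4, 0 ≤ U x) →
        (∀ x ∈ ball (0 : EuclideanSpace ℝ (Fin N)) 4, Lminus Λ α β ε U x ≤ 1) →
        (∃ x ∈ ball (0 : EuclideanSpace ℝ (Fin N)) 3, U x ≤ 1) →
        ENNReal.ofReal κ * volume (ball (0 : EuclideanSpace ℝ (Fin N)) 1) ≤
          volume {x ∈ ball (0 : EuclideanSpace ℝ (Fin N)) 1 | U x ≤ M} := by
  obtain ⟨γ, A, C, ε₁, hγ, hA, hC, hε₁, hcontact⟩ :=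
    exists_contact_point N (η := (1 / 40) ^ N / 4) hΛ hβ hα hαβ (by positivity)
  set K : ℝ := (2 * C) ^ N / ((1 / 40) ^ N / 2) with hK
  have hK0 : 0 < K := by positivity
  refine ⟨A + 1, K⁻¹ * (1 / 2) ^ N, min ε₁ (min (1 / 2) (1 / C)), by linarith, by positivity,
    by positivity, ?_⟩
  intro ε hε hεlt U hU hb hU0 hL hx₁
  have hεε₁ : ε < ε₁ := hεlt.trans_le (min_le_left _ _)
  have hε2 : ε < 1 / 2 := hεlt.trans_le ((min_le_right _ _).trans (min_le_left _ _))
  have hεC : C * ε ^ 2 ≤ 1 := by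
    have := hεlt.trans_le ((min_le_right _ _).trans (min_le_right _ _))
    rw [lt_div_iff₀ hC] at this
    nlinarith
  have hcon := hcontact ε hε hεε₁ U hU hb hU0 hL hx₁
  choose! x hx m hm hUm hbad using hcon
  set ω := volume (ball (0 : EuclideanSpace ℝ (Fin N)) 1) with hω
  set S := {x ∈ ball (0 : EuclideanSpace ℝ (Fin N)) 1 | U x ≤ A + 1} with hS
  have hSm : MeasurableSet S :=
    measurableSet_ball.inter (measurableSet_le hU measurable_const)
  obtain ⟨u, hut, hdisj, hcov⟩ := Vitali.exists_disjoint_subfamily_covering_enlargement_closedBall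
    (ball (0 : EuclideanSpace ℝ (Fin N)) (1 / 2)) x (fun _ => ε / 40) (ε / 40)
    (fun _ _ => le_rfl) 5 (by norm_num)
  have hcount : u.Countable := hdisj.countable_of_nonempty_interior fun a _ =>
    ⟨x a, ball_subset_interior_closedBall (mem_ball_self (by positivity))⟩
  have hgood : ∀ b ∈ u, ENNReal.ofReal ((1 / 40) ^ N / 2 * ε ^ N) * ω ≤
      volume (closedBall (x b) (ε / 40) ∩ S) := by
    intro b hbu
    refine volume_closedBall_inter_ge hε (hbad b (hut hbu)) fun z hz => ?_
    have hz' : ‖z - x b‖ ≤ ε / 40 := mem_closedBall_iff_norm.1 hz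
    have hxb : ‖x b‖ < 1 / 2 := mem_ball_zero_iff.1 (hx b (hut hbu))
    by_cases h : testFun γ A b z + m b + C * ε ^ 2 < U z
    · exact Or.inr ⟨mem_ball_iff_norm.2 (by linarith), h⟩
    · refine Or.inl ⟨?_, ?_⟩
      · rw [mem_ball_zero_iff]
        calc ‖z‖ = ‖(z - x b) + x b‖ := by congr 1; abel
          _ ≤ ‖z - x b‖ + ‖x b‖ := norm_add_le _ _
          _ < 1 := by linarith
      · have h1 := testFun_le hγ.le hA.le b z
        have h2 := hm b (hut hbu)
        linarith [not_lt.1 h]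
  have hcover : ball (0 : EuclideanSpace ℝ (Fin N)) (1 / 2) ⊆
      ⋃ b ∈ u, closedBall b (2 * C * ε) := by
    intro a ha
    obtain ⟨b, hbu, hab⟩ := hcov a ha
    refine Set.mem_biUnion hbu ?_
    rw [mem_closedBall]
    have hd : dist (x a) (x b) ≤ ε / 8 := by
      have := mem_closedBall.1 (hab (mem_closedBall_self (by positivity)))
      linarith
    rcases (dist_nonneg (x := a) (y := b)).eq_or_lt with h | h
    · rw [← h]; positivity
    · exact dist_vertices_le hε (by linarith) (hx a ha) hd (hUm a ha) (hUm b (hut hbu))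
        (hbad a ha) (hbad b (hut hbu)) h
  have hsum : ∑' b : u, volume (closedBall (x b) (ε / 40) ∩ S) ≤ volume S := by
    rw [← measure_biUnion hcount (fun a ha b hb' hab =>
      (hdisj ha hb' hab).mono Set.inter_subset_left Set.inter_subset_left)
      (fun b _ => measurableSet_closedBall.inter hSm)]
    exact measure_mono (Set.iUnion₂_subset fun b _ => Set.inter_subset_right)
  have hhalf : ENNReal.ofReal ((1 / 2) ^ N) * ω ≤ ENNReal.ofReal K * volume S := by
    calc ENNReal.ofReal ((1 / 2) ^ N) * ω
        = volume (ball (0 : EuclideanSpace ℝ (Fin N)) (1 / 2)) := by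
          rw [Measure.addHaar_ball_of_pos _ _ (by norm_num), finrank_euclideanSpace_fin]
      _ ≤ volume (⋃ b ∈ u, closedBall b (2 * C * ε)) := measure_mono hcover
      _ ≤ ∑' b : u, volume (closedBall (b : EuclideanSpace ℝ (Fin N)) (2 * C * ε)) :=
          measure_biUnion_le _ hcount _
      _ ≤ ∑' b : u, ENNReal.ofReal K * volume (closedBall (x b) (ε / 40) ∩ S) := by
          refine ENNReal.tsum_le_tsum fun b => ?_
          rw [Measure.addHaar_closedBall _ _ (by positivity), finrank_euclideanSpace_fin]
          refine le_trans (le_of_eq ?_) (mul_le_mul_right (hgood b b.2) _)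
          rw [← mul_assoc, ← ENNReal.ofReal_mul hK0.le]
          congr 2
          rw [hK, mul_pow]
          field_simp
      _ = ENNReal.ofReal K * ∑' b : u, volume (closedBall (x b) (ε / 40) ∩ S) :=
          ENNReal.tsum_mul_left
      _ ≤ _ := mul_le_mul_right hsum _
  calc ENNReal.ofReal (K⁻¹ * (1 / 2) ^ N) * ω
      = ENNReal.ofReal K⁻¹ * (ENNReal.ofReal ((1 / 2) ^ N) * ω) := by
        rw [ENNReal.ofReal_mul (by positivity), mul_assoc]
    _ ≤ ENNReal.ofReal K⁻¹ * (ENNReal.ofReal K * volume S) := mul_le_mul_right hhalf _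
    _ = volume S := by
        rw [← mul_assoc, ← ENNReal.ofReal_mul (by positivity), inv_mul_cancel₀ hK0.ne',
          ENNReal.ofReal_one, one_mul]

theorem Lminus_add_const {N : ℕ} (Λ α β ε c : ℝ) (U : EuclideanSpace ℝ (Fin N) → ℝ)
    (x : EuclideanSpace ℝ (Fin N)) :
    Lminus Λ α β ε (fun z => U z + c) x = Lminus Λ α β ε U x := by
  have h : ∀ y, ddiff (fun z => U z + c) x y = ddiff U x y := fun y => by
    simp only [ddiff]
    ring
  simp only [Lminus, h]

theorem Lminus_const_sub {N : ℕ} (Λ α β ε c : ℝ) (U : EuclideanSpace ℝ (Fin N) → ℝ)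
    (x : EuclideanSpace ℝ (Fin N)) :
    Lminus Λ α β ε (fun z => c - U z) x = -Lplus Λ α β ε U x := by
  have h : ∀ y, ddiff (fun z => c - U z) x y = -ddiff U x y := fun y => by
    simp only [ddiff]
    ring
  have h2 : (fun z => -ddiff U x (ε • z)) '' ball (0 : EuclideanSpace ℝ (Fin N)) Λ =
      -((fun z => ddiff U x (ε • z)) '' ball (0 : EuclideanSpace ℝ (Fin N)) Λ) := by
    rw [← Set.image_neg_eq_neg, Set.image_image]
  simp only [Lminus, Lplus, h, h2, Real.sInf_neg, average_neg]
  ring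

theorem Lminus_rescale {N : ℕ} {Λ α β ε t k : ℝ} (ht : 0 < t) (hk : 0 < k)
    (U : EuclideanSpace ℝ (Fin N) → ℝ) (x₀ x : EuclideanSpace ℝ (Fin N)) :
    Lminus Λ α β (ε / t) (fun z => k⁻¹ * U (x₀ + t • z)) x =
      t ^ 2 / k * Lminus Λ α β ε U (x₀ + t • x) := by
  have h : ∀ y, ddiff (fun z => k⁻¹ * U (x₀ + t • z)) x ((ε / t) • y) =
      k⁻¹ * ddiff U (x₀ + t • x) (ε • y) := fun y => by
    have e : t • (ε / t) • y = ε • y := by rw [smul_smul, mul_div_cancel₀ _ ht.ne']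
    simp only [ddiff, smul_add, smul_sub, e, add_sub_assoc, add_assoc]
    ring
  have h2 : (fun z => k⁻¹ * ddiff U (x₀ + t • x) (ε • z)) ''
      ball (0 : EuclideanSpace ℝ (Fin N)) Λ =
      k⁻¹ • ((fun z => ddiff U (x₀ + t • x) (ε • z)) ''
        ball (0 : EuclideanSpace ℝ (Fin N)) Λ) := by
    rw [← Set.image_smul, Set.image_image]
    rfl
  simp only [Lminus, h, h2, Real.sInf_smul_of_nonneg (inv_nonneg.2 hk.le), smul_eq_mul,
    setAverage_eq, integral_const_mul]
  rcases eq_or_ne ε 0 with rfl | hε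
  · simp
  · field_simp

/-- If `w` is nonnegative in `B_{4t}(x₀)` and at most `k` somewhere in `B_{3t}(x₀)`, then it is at
most `M k` on a fixed proportion of `B_t(x₀)`. -/
def MeasureEstimate {N : ℕ} (ρ M κ : ℝ) (w : EuclideanSpace ℝ (Fin N) → ℝ) : Prop :=
  ∀ (x₀ : EuclideanSpace ℝ (Fin N)) (t k : ℝ), 0 < t → 0 < k → ‖x₀‖ + 4 * t ≤ 3 →
    (∀ x ∈ ball x₀ (4 * t), 0 ≤ w x) → t ^ 2 * ρ ≤ k → (∃ x ∈ ball x₀ (3 * t), w x ≤ k) →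
    ENNReal.ofReal κ * volume (ball x₀ t) ≤ volume {x ∈ ball x₀ t | w x ≤ M * k}

/-- The measure estimate holds for limits of supersolutions. -/
theorem exists_measureEstimate_limit (N : ℕ) {Λ α β : ℝ} (hΛ : 1 ≤ Λ) (hβ : 0 < β) (hα : 0 ≤ α)
    (hαβ : α + β = 1) :
    ∃ M κ : ℝ, 2 ≤ M ∧ 0 < κ ∧ ∀ (ρ : ℝ) (G : ℝ → EuclideanSpace ℝ (Fin N) → ℝ)
      (w : EuclideanSpace ℝ (Fin N) → ℝ),
      (∀ ε ∈ Set.Ioo (0 : ℝ) 1, Measurable (G ε) ∧ (∃ K, ∀ x, |G ε x| ≤ K) ∧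
        ∀ x ∈ ball (0 : EuclideanSpace ℝ (Fin N)) 3, Lminus Λ α β ε (G ε) x ≤ ρ) →
      TendstoUniformlyOn G w (𝓝[>] 0) (ball 0 3) → MeasureEstimate ρ M κ w := by
  obtain ⟨M, κ, ε₁, hM, hκ, hε₁, H⟩ := exists_measure_estimate_unit N hΛ hβ hα hαβ
  refine ⟨2 * M, κ, by linarith, hκ, ?_⟩
  intro ρ G w hG hlim x₀ t k ht hk hsub hw hρ ⟨x₁, hx₁, hwx₁⟩
  have hmaps : ∀ r, r ≤ 4 → ∀ x ∈ ball (0 : EuclideanSpace ℝ (Fin N)) r,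
      x₀ + t • x ∈ ball x₀ (r * t) := by
    intro r _ x hx
    rw [mem_ball_iff_norm, add_sub_cancel_left, norm_smul, Real.norm_of_nonneg ht.le, mul_comm]
    exact mul_lt_mul_of_pos_right (mem_ball_zero_iff.1 hx) ht
  have hin3 : ball x₀ (4 * t) ⊆ ball (0 : EuclideanSpace ℝ (Fin N)) 3 :=
    ball_subset_ball' (by rw [dist_zero_right]; linarith)
  have hmin : (0 : ℝ) < min 1 (ε₁ * t) := lt_min one_pos (by positivity)
  obtain ⟨ε, hclose, hε0, hεlt⟩ := ((Metric.tendstoUniformlyOn_iff.1 hlim (k / 2)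
    (by positivity)).and (show ∀ᶠ ε in 𝓝[>] (0 : ℝ), ε ∈ Set.Ioo 0 (min 1 (ε₁ * t)) from
      Ioo_mem_nhdsGT hmin)).exists
  obtain ⟨hmeas, ⟨K, hK⟩, hL⟩ := hG ε ⟨hε0, hεlt.trans_le (min_le_left _ _)⟩
  have hclose' : ∀ x ∈ ball x₀ (4 * t), |w x - G ε x| < k / 2 := fun x hx => by
    have := hclose x (hin3 hx)
    rwa [Real.dist_eq] at this
  set V : EuclideanSpace ℝ (Fin N) → ℝ := fun z => (2 * k)⁻¹ * (G ε (x₀ + t • z) + k / 2) with hV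
  have h2k : 0 < 2 * k := by positivity
  have key := H (ε / t) (by positivity)
    (by rw [div_lt_iff₀ ht]; exact hεlt.trans_le (min_le_right _ _)) V (by fun_prop)
    ⟨(2 * k)⁻¹ * (K + k / 2), fun x => ?_⟩ (fun x hx => ?_) (fun x hx => ?_)
    ⟨t⁻¹ • (x₁ - x₀), ?_, ?_⟩
  · calc ENNReal.ofReal κ * volume (ball x₀ t)
        = ENNReal.ofReal (t ^ N) * (ENNReal.ofReal κ *
            volume (ball (0 : EuclideanSpace ℝ (Fin N)) 1)) := by
          rw [Measure.addHaar_ball_of_pos _ _ ht, finrank_euclideanSpace_fin]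
          ring
      _ ≤ ENNReal.ofReal (t ^ N) *
            volume {x ∈ ball (0 : EuclideanSpace ℝ (Fin N)) 1 | V x ≤ M} := by gcongr
      _ = volume ((fun h => x₀ + t • h) ''
            {x ∈ ball (0 : EuclideanSpace ℝ (Fin N)) 1 | V x ≤ M}) :=
          (volume_add_smul_image x₀ ht.le _).symm
      _ ≤ _ := by
          refine measure_mono ?_
          rintro _ ⟨z, ⟨hz, hVz⟩, rfl⟩
          have h1 := hmaps 1 (by norm_num) z hz
          rw [one_mul] at h1
          have h2 := (abs_lt.1 (hclose' _ (ball_subset_ball (by linarith) h1))).2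
          refine ⟨h1, ?_⟩
          simp only [hV] at hVz
          rw [inv_mul_le_iff₀ h2k] at hVz
          simp only
          linarith
  · simp only [hV]
    rw [abs_mul, abs_of_pos (inv_pos.2 h2k)]
    gcongr
    refine (abs_add_le _ _).trans ?_
    rw [abs_of_pos (half_pos hk)]
    linarith [hK (x₀ + t • x)]
  · have h1 := hmaps 4 le_rfl x hx
    have h2 := (abs_lt.1 (hclose' _ h1)).2
    have h3 := hw _ h1
    exact mul_nonneg (inv_nonneg.2 h2k.le) (by linarith)
  · have h1 := hL _ (hin3 (hmaps 4 le_rfl x hx))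
    have h2 := Lminus_rescale (Λ := Λ) (α := α) (β := β) (ε := ε) ht h2k
      (fun z => G ε z + k / 2) x₀ x
    simp only [hV]
    rw [h2, Lminus_add_const]
    have h3 : t ^ 2 / (2 * k) * Lminus Λ α β ε (G ε) (x₀ + t • x) ≤ t ^ 2 / (2 * k) * ρ := by
      gcongr
    refine h3.trans ?_
    rw [div_mul_eq_mul_div, div_le_one h2k]
    linarith
  · rw [mem_ball_zero_iff, norm_smul, norm_inv, Real.norm_of_nonneg ht.le, inv_mul_lt_iff₀ ht,
      mul_comm]
    exact mem_ball_iff_norm.1 hx₁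
  · have h1 := (abs_lt.1 (hclose' x₁ (ball_subset_ball (by linarith) hx₁))).1
    simp only [hV]
    rw [smul_inv_smul₀ ht.ne', add_sub_cancel, inv_mul_le_iff₀ h2k]
    linarith

/-- At almost every point of a measurable subset `E` of a ball, the balls shrinking towards the
point inside the large ball are eventually filled by `E` up to a small proportion. -/
theorem ae_eventually_volume_diff_lt {N : ℕ} {R κ : ℝ} (hR : 0 < R) (hκ : 0 < κ)
    {E : Set (EuclideanSpace ℝ (Fin N))} (hE : MeasurableSet E)
    (hER : E ⊆ ball 0 R) :
    ∀ᵐ x ∂(volume.restrict E), ∀ᶠ j : ℕ in Filter.atTop,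
      volume (ball ((1 - (1 / 2 : ℝ) ^ j) • x) ((1 / 2) ^ j * R) \ E) <
        ENNReal.ofReal κ * volume (ball ((1 - (1 / 2 : ℝ) ^ j) • x) ((1 / 2) ^ j * R)) := by
  filter_upwards [IsUnifLocDoublingMeasure.ae_tendsto_measure_inter_div
    (volume : Measure (EuclideanSpace ℝ (Fin N))) E 1, ae_restrict_mem hE] with x hx hxE
  have hxR : ‖x‖ < R := mem_ball_zero_iff.1 (hER hxE)
  have hδ : Filter.Tendsto (fun j : ℕ => (1 / 2 : ℝ) ^ j * R) Filter.atTop (𝓝[>] 0) := by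
    refine tendsto_nhdsWithin_iff.2 ⟨?_, Filter.Eventually.of_forall fun j => ?_⟩
    · simpa using (tendsto_pow_atTop_nhds_zero_of_lt_one (by norm_num : (0 : ℝ) ≤ 1 / 2)
        (by norm_num)).mul_const R
    · exact Set.mem_Ioi.2 (by positivity)
  have hlim := hx (fun j : ℕ => (1 - (1 / 2 : ℝ) ^ j) • x) (fun j : ℕ => (1 / 2 : ℝ) ^ j * R) hδ
    (Filter.Eventually.of_forall fun j => by
      rw [mem_closedBall_iff_norm, one_mul]
      have : x - (1 - (1 / 2 : ℝ) ^ j) • x = ((1 / 2 : ℝ) ^ j) • x := by module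
      rw [this, norm_smul, Real.norm_of_nonneg (by positivity)]
      gcongr)
  have hlt : 1 - ENNReal.ofReal κ < 1 :=
    ENNReal.sub_lt_self ENNReal.one_ne_top one_ne_zero (ENNReal.ofReal_pos.2 hκ).ne'
  filter_upwards [hlim.eventually (lt_mem_nhds hlt)] with j hj
  set z := (1 - (1 / 2 : ℝ) ^ j) • x
  set r := (1 / 2 : ℝ) ^ j * R with hr
  have hr0 : 0 < r := by positivity
  have hvol : volume (closedBall z r) = volume (ball z r) := by
    rw [Measure.addHaar_closedBall _ _ hr0.le, Measure.addHaar_ball_of_pos _ _ hr0]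
  have hfin : volume (closedBall z r) ≠ ⊤ := measure_closedBall_lt_top.ne
  have hne : volume (closedBall z r) ≠ 0 := (measure_closedBall_pos _ _ hr0).ne'
  rw [ENNReal.lt_div_iff_mul_lt (Or.inl hne) (Or.inl hfin), Set.inter_comm] at hj
  have hsplit := measure_inter_add_sdiff (μ := volume) (closedBall z r) hE
  have hd : volume (closedBall z r \ E) < ENNReal.ofReal κ * volume (closedBall z r) := by
    by_contra! hcon
    have hfin' : ENNReal.ofReal κ * volume (closedBall z r) ≠ ⊤ :=
      ENNReal.mul_ne_top ENNReal.ofReal_ne_top hfin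
    have h1 : volume (closedBall z r) ≤ (1 - ENNReal.ofReal κ) * volume (closedBall z r) +
        ENNReal.ofReal κ * volume (closedBall z r) := by
      rw [← add_mul]
      calc volume (closedBall z r) = 1 * volume (closedBall z r) := (one_mul _).symm
        _ ≤ _ := by
          gcongr
          exact le_tsub_add
    have h2 : (1 - ENNReal.ofReal κ) * volume (closedBall z r) +
        ENNReal.ofReal κ * volume (closedBall z r) < volume (closedBall z r ∩ E) +
          volume (closedBall z r \ E) := by
      calc _ < volume (closedBall z r ∩ E) + ENNReal.ofReal κ * volume (closedBall z r) :=
            ENNReal.add_lt_add_right hfin' hj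
        _ ≤ _ := by gcongr
    rw [hsplit] at h2
    exact absurd (h1.trans_lt h2) (lt_irrefl _)
  calc volume (ball z r \ E) ≤ volume (closedBall z r \ E) :=
        measure_mono (Set.sdiff_subset_sdiff_left ball_subset_closedBall)
    _ < _ := by rw [← hvol]; exact hd

/-- **Growing ink spots.** -/
theorem growing_ink_spots {N : ℕ} {R κ : ℝ} (hR : 0 < R) (hκ : 0 < κ)
    {E F : Set (EuclideanSpace ℝ (Fin N))} (hE : MeasurableSet E) (hF : MeasurableSet F)
    (hER : E ⊆ ball 0 R) (hEF : E ⊆ F)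
    (hbase : ENNReal.ofReal κ * volume (ball (0 : EuclideanSpace ℝ (Fin N)) R) ≤
      volume (ball 0 R \ E))
    (hstep : ∀ (z : EuclideanSpace ℝ (Fin N)) (t : ℝ), 0 < t → t ≤ R / 2 → ‖z‖ + t ≤ R →
      volume (ball z t \ E) < ENNReal.ofReal κ * volume (ball z t) →
      ball z (3 * t) ∩ ball 0 R ⊆ F) :
    ENNReal.ofReal (1 + κ / 5 ^ N) * volume E ≤ volume F := by
  set zz : EuclideanSpace ℝ (Fin N) → ℕ → EuclideanSpace ℝ (Fin N) :=
    fun x j => (1 - (1 / 2 : ℝ) ^ j) • x with hzz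
  set rr : ℕ → ℝ := fun j => (1 / 2) ^ j * R with hrr
  have hrr0 : ∀ j, 0 < rr j := fun j => by simp only [hrr]; positivity
  have hinside : ∀ x ∈ ball (0 : EuclideanSpace ℝ (Fin N)) R, ∀ j, ‖zz x j‖ + rr j ≤ R := by
    intro x hx j
    have h1 : (1 / 2 : ℝ) ^ j ≤ 1 := pow_le_one₀ (by norm_num) (by norm_num)
    simp only [hzz, hrr]
    rw [norm_smul, Real.norm_of_nonneg (by linarith)]
    nlinarith [mul_le_mul_of_nonneg_left (mem_ball_zero_iff.1 hx).le (sub_nonneg.2 h1)]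
  set E' := {x ∈ E | ∀ᶠ j : ℕ in Filter.atTop, volume (ball (zz x j) (rr j) \ E) <
    ENNReal.ofReal κ * volume (ball (zz x j) (rr j))} with hE'
  have hE'vol : volume E ≤ volume E' := by
    have h1 := ae_eventually_volume_diff_lt hR hκ hE hER
    rw [ae_restrict_iff' hE] at h1
    refine measure_mono_ae ?_
    filter_upwards [h1] with x hx hxE
    exact ⟨hxE, hx hxE⟩
  have hchoice : ∀ x ∈ E', ∃ j : ℕ,
      ENNReal.ofReal κ * volume (ball (zz x j) (rr j)) ≤
        volume (ball (zz x j) (rr j) ∩ (F \ E)) := by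
    intro x ⟨hxE, hxev⟩
    have hxR := hER hxE
    classical
    have hex : ∃ j : ℕ, volume (ball (zz x j) (rr j) \ E) <
        ENNReal.ofReal κ * volume (ball (zz x j) (rr j)) := hxev.exists
    obtain ⟨i, hi⟩ : ∃ i, Nat.find hex = i + 1 := by
      refine Nat.exists_eq_succ_of_ne_zero fun h0 => ?_
      have h1 := Nat.find_spec hex
      rw [h0] at h1
      simp only [hzz, hrr, pow_zero, sub_self, zero_smul, one_mul] at h1
      exact absurd hbase (not_le.2 h1)
    have hgood := Nat.find_spec hex
    rw [hi] at hgood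
    have hbad : ¬ _ := Nat.find_min hex (by rw [hi]; exact Nat.lt_succ_self i)
    rw [not_lt] at hbad
    have hri : rr i = 2 * rr (i + 1) := by simp only [hrr, pow_succ]; ring
    have h1 : (1 / 2 : ℝ) ^ i ≤ 1 := pow_le_one₀ (by norm_num) (by norm_num)
    have hFi : ball (zz x i) (rr i) ⊆ F := by
      refine subset_trans (Set.subset_inter ?_ ?_)
        (hstep (zz x (i + 1)) (rr (i + 1)) (hrr0 _) ?_ (hinside x hxR _) hgood)
      · refine ball_subset_ball' ?_
        have h2 : zz x i - zz x (i + 1) = (-((1 / 2 : ℝ) ^ (i + 1))) • x := by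
          simp only [hzz, pow_succ]
          module
        rw [dist_eq_norm, h2, norm_smul, norm_neg, Real.norm_of_nonneg (by positivity), hri]
        have h3 : (1 / 2 : ℝ) ^ (i + 1) * ‖x‖ ≤ rr (i + 1) := by
          simp only [hrr]
          gcongr
          exact (mem_ball_zero_iff.1 hxR).le
        linarith
      · exact ball_subset_ball' (by rw [dist_zero_right]; linarith [hinside x hxR i])
      · have : rr i ≤ R := by simp only [hrr]; nlinarith
        linarith
    refine ⟨i, hbad.trans (measure_mono fun y hy => ⟨hy.1, hFi hy.1, hy.2⟩)⟩
  choose! j hj using hchoice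
  obtain ⟨u, hut, hdisj, hcov⟩ := Vitali.exists_disjoint_subfamily_covering_enlargement_closedBall
    E' (fun x => zz x (j x)) (fun x => rr (j x)) R (fun x hx => by
      have := hinside x (hER hx.1) (j x)
      linarith [norm_nonneg (zz x (j x))]) 5 (by norm_num)
  have hcount : u.Countable := hdisj.countable_of_nonempty_interior fun a _ =>
    ⟨zz a (j a), ball_subset_interior_closedBall (mem_ball_self (hrr0 _))⟩
  have hcover : E' ⊆ ⋃ b ∈ u, closedBall (zz b (j b)) (5 * rr (j b)) := by
    intro a ha
    obtain ⟨b, hbu, hab⟩ := hcov a ha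
    refine Set.mem_biUnion hbu (hab ?_)
    rw [mem_closedBall_iff_norm]
    have : a - zz a (j a) = ((1 / 2 : ℝ) ^ j a) • a := by simp only [hzz]; module
    rw [this, norm_smul, Real.norm_of_nonneg (by positivity)]
    simp only [hrr]
    gcongr
    exact (mem_ball_zero_iff.1 (hER ha.1)).le
  have hsum : ∑' b : u, volume (ball (zz b (j b)) (rr (j b)) ∩ (F \ E)) ≤ volume (F \ E) := by
    rw [← measure_biUnion hcount (fun a ha b hb' hab =>
      (hdisj ha hb' hab).mono (Set.inter_subset_left.trans ball_subset_closedBall)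
        (Set.inter_subset_left.trans ball_subset_closedBall))
      (fun b _ => measurableSet_ball.inter (hF.diff hE))]
    exact measure_mono (Set.iUnion₂_subset fun b _ => Set.inter_subset_right)
  have hmain : ENNReal.ofReal (κ / 5 ^ N) * volume E ≤ volume (F \ E) := by
    calc ENNReal.ofReal (κ / 5 ^ N) * volume E
        ≤ ENNReal.ofReal (κ / 5 ^ N) * ∑' b : u,
            volume (closedBall (zz b (j b)) (5 * rr (j b))) := by
          gcongr
          exact hE'vol.trans ((measure_mono hcover).trans (measure_biUnion_le _ hcount _))
      _ = ∑' b : u, ENNReal.ofReal κ * volume (ball (zz b (j b)) (rr (j b))) := by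
          rw [← ENNReal.tsum_mul_left]
          refine tsum_congr fun b => ?_
          have hb0 := hrr0 (j b)
          generalize rr (j b) = s at hb0 ⊢
          rw [Measure.addHaar_closedBall _ _ (by positivity), Measure.addHaar_ball_of_pos _ _ hb0,
            finrank_euclideanSpace_fin, ← mul_assoc, ← mul_assoc (ENNReal.ofReal κ),
            ← ENNReal.ofReal_mul (by positivity), ← ENNReal.ofReal_mul hκ.le, mul_pow]
          congr 2
          field_simp
      _ ≤ ∑' b : u, volume (ball (zz b (j b)) (rr (j b)) ∩ (F \ E)) :=
          ENNReal.tsum_le_tsum fun b => hj b (hut b.2)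
      _ ≤ _ := hsum
  calc ENNReal.ofReal (1 + κ / 5 ^ N) * volume E
      = volume E + ENNReal.ofReal (κ / 5 ^ N) * volume E := by
        rw [ENNReal.ofReal_add zero_le_one (by positivity), add_mul, ENNReal.ofReal_one, one_mul]
    _ ≤ volume E + volume (F \ E) := by gcongr
    _ = volume F := by
        rw [← measure_inter_add_sdiff F hE, Set.inter_eq_self_of_subset_right hEF]

theorem volume_ball_eq_pow_mul {N : ℕ} (x : EuclideanSpace ℝ (Fin N)) {r : ℝ} (hr : 0 < r) :
    volume (ball x r) =
      ENNReal.ofReal (r ^ N) * volume (ball (0 : EuclideanSpace ℝ (Fin N)) 1) := by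
  rw [Measure.addHaar_ball_of_pos _ _ hr, finrank_euclideanSpace_fin]

/-- The hypotheses on a limit function `u` that drive the Harnack inequality: positivity, the
measure estimate for `u` and for `c - u`, and a point of the unit ball where `u ≤ k`. -/
structure HarnackData {N : ℕ} (ρ M κ k : ℝ) (u : EuclideanSpace ℝ (Fin N) → ℝ) : Prop where
  two_le : 2 ≤ M
  pos_κ : 0 < κ
  pos_k : 0 < k
  nonneg_ρ : 0 ≤ ρ
  ρ_le : ρ ≤ k
  nonneg : ∀ x ∈ ball (0 : EuclideanSpace ℝ (Fin N)) 3, 0 ≤ u x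
  measurableSet : ∀ c, MeasurableSet {x ∈ ball (0 : EuclideanSpace ℝ (Fin N)) (11 / 10) | c < u x}
  estimate : MeasureEstimate ρ M κ u
  estimate_sub : ∀ c, MeasureEstimate ρ M κ fun x => c - u x
  exists_le : ∃ x ∈ ball (0 : EuclideanSpace ℝ (Fin N)) 1, u x ≤ k

namespace HarnackData

variable {N : ℕ} {ρ M κ k : ℝ} {u : EuclideanSpace ℝ (Fin N) → ℝ}

theorem sq_mul_le (H : HarnackData ρ M κ k u) {t : ℝ} (ht : 0 ≤ t) (ht1 : t ≤ 1) :
    t ^ 2 * ρ ≤ k := by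
  have h1 : t ^ 2 * ρ ≤ 1 * ρ := mul_le_mul_of_nonneg_right (pow_le_one₀ ht ht1) H.nonneg_ρ
  linarith [H.ρ_le]

theorem le_pow_mul (H : HarnackData ρ M κ k u) (j : ℕ) : k ≤ M ^ j * k :=
  le_mul_of_one_le_left H.pos_k.le (one_le_pow₀ (by linarith [H.two_le]))

theorem volume_superlevel_succ_le (H : HarnackData ρ M κ k u) (j : ℕ) :
    ENNReal.ofReal (1 + κ * (6 / 11) ^ N / 5 ^ N) *
        volume {x ∈ ball (0 : EuclideanSpace ℝ (Fin N)) (11 / 10) | M ^ (j + 1) * k < u x} ≤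
      volume {x ∈ ball (0 : EuclideanSpace ℝ (Fin N)) (11 / 10) | M ^ j * k < u x} := by
  have hk := H.pos_k
  have hκ := H.pos_κ
  have hM := H.two_le
  have hMj : k ≤ M ^ j * k := H.le_pow_mul j
  have hsucc : M ^ (j + 1) * k = M * (M ^ j * k) := by ring
  have hMk : M ^ j * k ≤ M * (M ^ j * k) :=
    le_mul_of_one_le_left (hk.le.trans hMj) (by linarith)
  have hκ' : κ * (6 / 11) ^ N ≤ κ :=
    mul_le_of_le_one_right hκ.le (pow_le_one₀ (by norm_num) (by norm_num))
  refine growing_ink_spots (R := 11 / 10) (by norm_num) (by positivity)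
    (H.measurableSet _) (H.measurableSet _) (fun x hx => hx.1)
    (fun x hx => ⟨hx.1, ?_⟩) ?_ ?_
  · have := hx.2
    linarith
  · obtain ⟨x, hx, hxk⟩ := H.exists_le
    have h1 := H.estimate 0 (3 / 5) k (by norm_num) hk (by rw [norm_zero]; norm_num)
      (fun y hy => H.nonneg y (ball_subset_ball (by norm_num) hy))
      (H.sq_mul_le (by norm_num) (by norm_num))
      ⟨x, ball_subset_ball (by norm_num) hx, hxk⟩
    calc _ = ENNReal.ofReal κ * volume (ball (0 : EuclideanSpace ℝ (Fin N)) (3 / 5)) := by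
          rw [volume_ball_eq_pow_mul 0 (r := 11 / 10) (by norm_num),
            volume_ball_eq_pow_mul 0 (r := 3 / 5) (by norm_num), ← mul_assoc, ← mul_assoc,
            ← ENNReal.ofReal_mul (by positivity), ← ENNReal.ofReal_mul hκ.le, mul_assoc κ,
            ← mul_pow]
          norm_num
      _ ≤ _ := by
        refine h1.trans (measure_mono fun y hy =>
          ⟨ball_subset_ball (by norm_num) hy.1, fun hy' => ?_⟩)
        have h2 := hy'.2
        have h3 := hy.2
        have h4 : M * k ≤ M * (M ^ j * k) := mul_le_mul_of_nonneg_left hMj (by linarith)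
        linarith
  · intro z t ht htR hzt hlt y ⟨hy, hyR⟩
    refine ⟨hyR, ?_⟩
    by_contra! hcon
    have h1 := H.estimate z t (M ^ j * k) ht (hk.trans_le hMj) (by linarith)
      (fun y hy => H.nonneg y (ball_subset_ball' (by rw [dist_zero_right]; linarith) hy))
      ((H.sq_mul_le ht.le (by linarith)).trans hMj) ⟨y, hy, hcon⟩
    have h2 : volume {x ∈ ball z t | u x ≤ M * (M ^ j * k)} ≤
        volume (ball z t \ {x ∈ ball (0 : EuclideanSpace ℝ (Fin N)) (11 / 10) |
          M ^ (j + 1) * k < u x}) := measure_mono fun y hy =>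
      ⟨hy.1, fun hy' => by linarith [hy.2, hy'.2]⟩
    have h3 : ENNReal.ofReal (κ * (6 / 11) ^ N) * volume (ball z t) ≤
        ENNReal.ofReal κ * volume (ball z t) := by gcongr
    exact absurd (hlt.trans_le (h3.trans (h1.trans h2))) (lt_irrefl _)

theorem pow_mul_volume_superlevel_le (H : HarnackData ρ M κ k u) (j : ℕ) :
    ENNReal.ofReal ((1 + κ * (6 / 11) ^ N / 5 ^ N) ^ j) *
        volume {x ∈ ball (0 : EuclideanSpace ℝ (Fin N)) (11 / 10) | M ^ j * k < u x} ≤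
      volume (ball (0 : EuclideanSpace ℝ (Fin N)) (11 / 10)) := by
  have hκ := H.pos_κ
  induction j with
  | zero =>
    rw [pow_zero, ENNReal.ofReal_one, one_mul]
    exact measure_mono fun x hx => hx.1
  | succ j ih =>
    rw [pow_succ, ENNReal.ofReal_mul (by positivity), mul_assoc]
    refine le_trans ?_ ih
    gcongr
    exact H.volume_superlevel_succ_le j

/-- If `u` is large at a point then it is even larger nearby, since otherwise the measure estimate
for `c - u` would contradict the decay of the superlevel sets. -/
theorem exists_lt_of_lt (H : HarnackData ρ M κ k u) {x : EuclideanSpace ℝ (Fin N)} {t h : ℝ}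
    {j : ℕ} (ht : 0 < t) (hxt : ‖x‖ + 4 * t ≤ 11 / 10) (hh : 2 * (M ^ (j + 1) * k) ≤ h)
    (hux : h < u x)
    (hκt : (11 / 10) ^ N < κ * t ^ N * (1 + κ * (6 / 11) ^ N / 5 ^ N) ^ (j + 1)) :
    ∃ x' ∈ ball x (4 * t), (1 + 1 / (2 * M)) * h < u x' := by
  by_contra! hcon
  have hk := H.pos_k
  have hκ := H.pos_κ
  have hM := H.two_le
  have hM0 : 0 < M := by linarith
  have ht1 : t ≤ 1 := by linarith [norm_nonneg x]
  have hMj : k ≤ M ^ j * k := H.le_pow_mul j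
  have hsucc : M ^ (j + 1) * k = M * (M ^ j * k) := by ring
  have hMk : M * k ≤ M * (M ^ j * k) := mul_le_mul_of_nonneg_left hMj hM0.le
  have hh0 : 0 < h := by
    have : 0 < M * k := by positivity
    linarith
  have hkh : k ≤ h / (2 * M) := by
    rw [le_div_iff₀ (by positivity)]
    linarith
  have hν : (1 + 1 / (2 * M)) * h = h + h / (2 * M) := by ring
  have h1 := H.estimate_sub ((1 + 1 / (2 * M)) * h) x t (h / (2 * M)) ht (by positivity)
    (by linarith) (fun y hy => sub_nonneg.2 (hcon y hy))
    ((H.sq_mul_le ht.le ht1).trans hkh)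
    ⟨x, mem_ball_self (by positivity), by linarith⟩
  have hMh : M * (h / (2 * M)) = h / 2 := by field_simp
  have h2 : volume {y ∈ ball x t | (1 + 1 / (2 * M)) * h - u y ≤ M * (h / (2 * M))} ≤
      volume {x ∈ ball (0 : EuclideanSpace ℝ (Fin N)) (11 / 10) | M ^ (j + 1) * k < u x} :=
    measure_mono fun y hy => by
      refine ⟨ball_subset_ball' (by rw [dist_zero_right]; linarith) hy.1, ?_⟩
      have h3 := hy.2
      rw [hMh] at h3
      linarith
  have h4 : ENNReal.ofReal ((1 + κ * (6 / 11) ^ N / 5 ^ N) ^ (j + 1)) *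
      (ENNReal.ofReal κ * volume (ball x t)) ≤
        volume (ball (0 : EuclideanSpace ℝ (Fin N)) (11 / 10)) :=
    le_trans (by gcongr; exact h1.trans h2) (H.pow_mul_volume_superlevel_le (j + 1))
  rw [volume_ball_eq_pow_mul x ht, volume_ball_eq_pow_mul 0 (r := 11 / 10) (by norm_num),
    ← mul_assoc, ← mul_assoc, ← ENNReal.ofReal_mul (by positivity),
    ← ENNReal.ofReal_mul (by positivity),
    ENNReal.mul_le_mul_iff_left (measure_ball_pos _ _ one_pos).ne' measure_ball_lt_top.ne,
    ENNReal.ofReal_le_ofReal_iff (by positivity)] at h4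
  linarith

/-- Iterating `exists_lt_of_lt` at a fixed scale. -/
theorem exists_lt_of_lt_iterate (H : HarnackData ρ M κ k u) {x : EuclideanSpace ℝ (Fin N)}
    {t h s : ℝ} {j : ℕ} (ht : 0 < t) (hs : 0 ≤ s) (hh : 2 * (M ^ (j + 1) * k) ≤ h)
    (hκt : (11 / 10) ^ N < κ * t ^ N * (1 + κ * (6 / 11) ^ N / 5 ^ N) ^ (j + 1)) (p : ℕ)
    (hxt : ‖x‖ + p * (4 * t) + s ≤ 11 / 10) (hux : h < u x) :
    ∃ x', ‖x'‖ + s ≤ 11 / 10 ∧ (1 + 1 / (2 * M)) ^ p * h < u x' := by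
  have hM := H.two_le
  have hν : 1 ≤ 1 + 1 / (2 * M) := le_add_of_nonneg_right (by positivity)
  have hh0 : 0 ≤ h := by
    have := H.le_pow_mul (j + 1)
    linarith [H.pos_k]
  induction p generalizing s with
  | zero => exact ⟨x, by simpa using hxt, by simpa using hux⟩
  | succ p ih =>
    push_cast at hxt
    obtain ⟨y, hy, huy⟩ := ih (s := s + 4 * t) (by positivity) (by linarith)
    obtain ⟨x', hx', hux'⟩ := H.exists_lt_of_lt ht (by linarith)
      (hh.trans (le_mul_of_one_le_left hh0 (one_le_pow₀ hν))) huy hκt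
    refine ⟨x', ?_, by rw [pow_succ', mul_assoc]; exact hux'⟩
    have h1 : ‖x'‖ ≤ ‖y‖ + ‖x' - y‖ := norm_le_insert' x' y
    have h2 := mem_ball_iff_norm.1 hx'
    linarith

end HarnackData

theorem exists_scale_constants {N : ℕ} (hN : 1 ≤ N) {θ κ : ℝ} (hθ : 1 < θ) (hκ : 0 < κ) (p : ℕ) :
    ∃ q a : ℝ, ∃ j₀ : ℕ, 0 < q ∧ q < 1 ∧ 0 < a ∧ (11 / 10) ^ N < κ * a ^ N ∧ 1 ≤ q ^ N * θ ∧
      p * (4 * (a * q ^ j₀)) / (1 - q) ≤ 1 / 10 := by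
  obtain ⟨q, hq0, hq1, hqN⟩ : ∃ q : ℝ, 0 < q ∧ q < 1 ∧ 1 ≤ q ^ N * θ := by
    have hN0 : (N : ℝ) ≠ 0 := by positivity
    have hθ0 : 0 < θ := by linarith
    refine ⟨θ ^ (-(N : ℝ)⁻¹), Real.rpow_pos_of_pos hθ0 _,
      Real.rpow_lt_one_of_one_lt_of_neg hθ (by simpa using Nat.pos_of_ne_zero (by omega)), ?_⟩
    rw [← Real.rpow_natCast, ← Real.rpow_mul hθ0.le, neg_mul, inv_mul_cancel₀ hN0,
      Real.rpow_neg_one, inv_mul_cancel₀ hθ0.ne']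
  obtain ⟨a, ha, ha'⟩ : ∃ a : ℝ, 0 < a ∧ (11 / 10) ^ N < κ * a ^ N := by
    refine ⟨1 + (11 / 10) ^ N / κ, by positivity, ?_⟩
    have h1 : 1 + (11 / 10 : ℝ) ^ N / κ ≤ (1 + (11 / 10) ^ N / κ) ^ N :=
      le_self_pow₀ (le_add_of_nonneg_right (by positivity)) (by omega)
    calc (11 / 10 : ℝ) ^ N < κ * (1 + (11 / 10) ^ N / κ) := by
          rw [mul_add, mul_div_cancel₀ _ hκ.ne']
          linarith
      _ ≤ _ := by gcongr
  have hlim : Filter.Tendsto (fun j : ℕ => p * (4 * (a * q ^ j)) / (1 - q)) Filter.atTop (𝓝 0) := by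
    simpa using ((((tendsto_pow_atTop_nhds_zero_of_lt_one hq0.le hq1).const_mul a).const_mul
      4).const_mul (p : ℝ)).div_const (1 - q)
  obtain ⟨j₀, hj⟩ := (hlim.eventually (ge_mem_nhds (by norm_num : (0 : ℝ) < 1 / 10))).exists
  exact ⟨q, a, j₀, hq0, hq1, ha, ha', hqN, hj⟩

/-- The Harnack inequality for functions satisfying the measure estimates. -/
theorem exists_forall_le_of_harnackData {N : ℕ} (hN : 1 ≤ N) {M κ : ℝ} (hM : 2 ≤ M)
    (hκ : 0 < κ) :
    ∃ C : ℝ, 0 < C ∧ ∀ (ρ k : ℝ) (u : EuclideanSpace ℝ (Fin N) → ℝ), HarnackData ρ M κ k u →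
      BddAbove (u '' ball 0 3) → ∀ x ∈ ball (0 : EuclideanSpace ℝ (Fin N)) 1, u x ≤ C * k := by
  set θ : ℝ := 1 + κ * (6 / 11) ^ N / 5 ^ N with hθ
  have hM0 : 0 < M := by linarith
  have hθ1 : 1 < θ := lt_add_of_pos_right _ (by positivity)
  obtain ⟨p, hp⟩ : ∃ p : ℕ, M < (1 + 1 / (2 * M)) ^ p :=
    pow_unbounded_of_one_lt _ (lt_add_of_pos_right _ (by positivity))
  obtain ⟨q, a, j₀, hq0, hq1, ha, haN, hqN, hj₀⟩ := exists_scale_constants hN hθ1 hκ p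
  have hq' : 0 < 1 - q := by linarith
  refine ⟨2 * M ^ (j₀ + 1), by positivity, fun ρ k u H ⟨K, hK⟩ x hx => ?_⟩
  by_contra! hcon
  have hk := H.pos_k
  have hgrow : ∀ i : ℕ, ∃ y : EuclideanSpace ℝ (Fin N),
      ‖y‖ + p * (4 * (a * q ^ (j₀ + i))) / (1 - q) ≤ 11 / 10 ∧
        2 * (M ^ (j₀ + i + 1) * k) < u y := by
    intro i
    induction i with
    | zero =>
      refine ⟨x, ?_, by rw [add_zero]; linarith⟩
      have := mem_ball_zero_iff.1 hx
      rw [add_zero]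
      linarith
    | succ i ih =>
      obtain ⟨y, hy, huy⟩ := ih
      have hscale : (11 / 10 : ℝ) ^ N < κ * (a * q ^ (j₀ + i)) ^ N * θ ^ (j₀ + i + 1) :=
        calc (11 / 10 : ℝ) ^ N < κ * a ^ N := haN
          _ ≤ κ * a ^ N * ((q ^ N * θ) ^ (j₀ + i) * θ) :=
              le_mul_of_one_le_right (by positivity)
                (one_le_mul_of_one_le_of_one_le (one_le_pow₀ hqN) hθ1.le)
          _ = _ := by
            rw [pow_succ θ, mul_pow a, mul_pow _ θ, ← pow_mul, ← pow_mul, mul_comm N]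
            ring
      have hpos : ‖y‖ + p * (4 * (a * q ^ (j₀ + i))) +
          p * (4 * (a * q ^ (j₀ + (i + 1)))) / (1 - q) ≤ 11 / 10 := by
        refine le_trans (le_of_eq ?_) hy
        rw [add_assoc, add_right_inj, ← add_assoc j₀, pow_succ]
        field_simp
        ring
      obtain ⟨y', hy', huy'⟩ := H.exists_lt_of_lt_iterate (by positivity) (by positivity) le_rfl
        hscale p hpos huy
      refine ⟨y', hy', lt_of_le_of_lt ?_ huy'⟩
      calc 2 * (M ^ (j₀ + (i + 1) + 1) * k) = M * (2 * (M ^ (j₀ + i + 1) * k)) := by ring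
        _ ≤ _ := by gcongr
  obtain ⟨i, hi⟩ := pow_unbounded_of_one_lt (K / k) (by linarith : 1 < M)
  obtain ⟨y, hy, huy⟩ := hgrow i
  have hy3 : y ∈ ball (0 : EuclideanSpace ℝ (Fin N)) 3 := by
    have : 0 ≤ p * (4 * (a * q ^ (j₀ + i))) / (1 - q) := by positivity
    rw [mem_ball_zero_iff]
    linarith
  have h1 := hK ⟨y, hy3, rfl⟩
  rw [div_lt_iff₀ hk] at hi
  have h2 : M ^ i * k ≤ M ^ (j₀ + i + 1) * k := by
    gcongr
    · linarith
    · omega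
  have h3 : 0 < M ^ i * k := by positivity
  linarith

theorem measurableSet_superlevel_of_tendstoUniformlyOn {N : ℕ}
    {U : ℝ → EuclideanSpace ℝ (Fin N) → ℝ} {u : EuclideanSpace ℝ (Fin N) → ℝ}
    {s : Set (EuclideanSpace ℝ (Fin N))} (hs : MeasurableSet s) {ε₀ : ℝ} (hε₀ : 0 < ε₀)
    (hU : ∀ ε ∈ Set.Ioo 0 ε₀, Measurable (U ε)) (hlim : TendstoUniformlyOn U u (𝓝[>] 0) s)
    (c : ℝ) : MeasurableSet {x ∈ s | c < u x} := by
  obtain ⟨e, -, he, he0⟩ := exists_seq_strictAnti_tendsto' hε₀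
  have he0' : Filter.Tendsto e Filter.atTop (𝓝[>] 0) :=
    tendsto_nhdsWithin_iff.2 ⟨he0, Filter.Eventually.of_forall fun n => (he n).1⟩
  have hmeas : Measurable (s.indicator u) := by
    refine measurable_of_tendsto_metrizable (f := fun n => s.indicator (U (e n)))
      (fun n => (hU _ (he n)).indicator hs) (tendsto_pi_nhds.2 fun x => ?_)
    by_cases hx : x ∈ s
    · simpa [hx, Function.comp_def] using (hlim.tendsto_at hx).comp he0'
    · simp [hx]
  have : {x ∈ s | c < u x} = s ∩ s.indicator u ⁻¹' Set.Ioi c := by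
    ext x
    by_cases hx : x ∈ s <;> simp [hx]
  rw [this]
  exact hs.inter (hmeas measurableSet_Ioi)

/-- **Harnack's inequality in the limit.** There exist `C > 0` and `ε₀ > 0`,
depending only on `N, Λ, α, β`, with the following property. Let `ρ ≥ 0` and for each
`ε ∈ (0, ε₀)` let `u_ε ≥ 0` be bounded Borel measurable with `L_ε^+ u_ε ≥ −ρ` and
`L_ε^- u_ε ≤ ρ` in `B_7`. If `u_ε → u` uniformly on `B_3` as `ε → 0⁺`, then
`sup_{B_1} u ≤ C (inf_{B_1} u + ρ)`. -/
theorem harnack_in_the_limit (N : ℕ) (hN : 1 ≤ N) (Λ α β : ℝ) (hΛ : 1 ≤ Λ)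
    (hβ : β ∈ Set.Ioc (0 : ℝ) 1) (hα : α = 1 - β) :
    ∃ (C ε₀ : ℝ), 0 < C ∧ 0 < ε₀ ∧
      ∀ ρ : ℝ, 0 ≤ ρ →
        ∀ U : ℝ → (EuclideanSpace ℝ (Fin N) → ℝ),
          (∀ ε ∈ Set.Ioo (0 : ℝ) ε₀,
            Measurable (U ε) ∧ (∃ K, ∀ x, |U ε x| ≤ K) ∧ (∀ x, 0 ≤ U ε x) ∧
            (∀ x ∈ ball (0 : EuclideanSpace ℝ (Fin N)) 7,
              -ρ ≤ Lplus Λ α β ε (U ε) x ∧ Lminus Λ α β ε (U ε) x ≤ ρ)) →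
          ∀ u : EuclideanSpace ℝ (Fin N) → ℝ,
            TendstoUniformlyOn U u (nhdsWithin 0 (Set.Ioi 0))
              (ball (0 : EuclideanSpace ℝ (Fin N)) 3) →
            sSup (u '' ball (0 : EuclideanSpace ℝ (Fin N)) 1) ≤
              C * (sInf (u '' ball (0 : EuclideanSpace ℝ (Fin N)) 1) + ρ) := by
  obtain ⟨M, κ, hM, hκ, hest⟩ := exists_measureEstimate_limit N hΛ hβ.1
    (by linarith [hβ.2] : 0 ≤ α) (by linarith)
  obtain ⟨C, hC, hbound⟩ := exists_forall_le_of_harnackData hN hM hκ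
  refine ⟨C, 1, hC, one_pos, fun ρ hρ U hU u hlim => ?_⟩
  have h37 : ball (0 : EuclideanSpace ℝ (Fin N)) 3 ⊆ ball 0 7 := ball_subset_ball (by norm_num)
  have h13 : ball (0 : EuclideanSpace ℝ (Fin N)) 1 ⊆ ball 0 3 := ball_subset_ball (by norm_num)
  have hev : ∀ᶠ ε in 𝓝[>] (0 : ℝ), ε ∈ Set.Ioo (0 : ℝ) 1 := Ioo_mem_nhdsGT one_pos
  have hnonneg : ∀ x ∈ ball (0 : EuclideanSpace ℝ (Fin N)) 3, 0 ≤ u x := fun x hx =>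
    ge_of_tendsto (hlim.tendsto_at hx) (hev.mono fun ε hε => (hU ε hε).2.2.1 x)
  have hbdd : BddAbove (u '' ball 0 3) := by
    obtain ⟨ε, hclose, hε⟩ := ((Metric.tendstoUniformlyOn_iff.1 hlim 1 one_pos).and hev).exists
    obtain ⟨K, hK⟩ := (hU ε hε).2.1
    refine ⟨K + 1, ?_⟩
    rintro _ ⟨x, hx, rfl⟩
    have h1 := hclose x hx
    rw [Real.dist_eq] at h1
    linarith [(abs_lt.1 h1).2, (abs_le.1 (hK x)).2]
  have hsub : ∀ c, MeasureEstimate ρ M κ fun x => c - u x := fun c => by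
    refine hest ρ (fun ε x => c - U ε x) _ (fun ε hε => ?_) ?_
    · obtain ⟨hm, ⟨K, hK⟩, -, hL⟩ := hU ε hε
      refine ⟨measurable_const.sub hm, ⟨|c| + K, fun x => ?_⟩, fun x hx => ?_⟩
      · exact (abs_sub _ _).trans (by linarith [hK x])
      · rw [Lminus_const_sub]
        linarith [(hL x (h37 hx)).1]
    · rw [Metric.tendstoUniformlyOn_iff] at hlim ⊢
      exact fun δ hδ => (hlim δ hδ).mono fun ε h x hx => by
        rw [dist_sub_left]
        exact h x hx
  have hmeasure : MeasureEstimate ρ M κ u := hest ρ U u (fun ε hε =>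
    ⟨(hU ε hε).1, (hU ε hε).2.1, fun x hx => ((hU ε hε).2.2.2 x (h37 hx)).2⟩) hlim
  have hne : (u '' ball (0 : EuclideanSpace ℝ (Fin N)) 1).Nonempty :=
    (nonempty_ball.2 one_pos).image _
  have hinf : 0 ≤ sInf (u '' ball (0 : EuclideanSpace ℝ (Fin N)) 1) :=
    Real.sInf_nonneg (by rintro _ ⟨x, hx, rfl⟩; exact hnonneg x (h13 hx))
  refine csSup_le hne ?_
  rintro _ ⟨x, hx, rfl⟩
  refine le_of_forall_pos_le_add fun δ hδ => ?_
  have hδC : 0 < δ / C := by positivity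
  obtain ⟨_, ⟨y, hy, rfl⟩, hyδ⟩ := Real.lt_sInf_add_pos hne hδC
  have := hbound ρ (sInf (u '' ball 0 1) + ρ + δ / C) u
    { two_le := hM
      pos_κ := hκ
      pos_k := by positivity
      nonneg_ρ := hρ
      ρ_le := by linarith
      nonneg := hnonneg
      measurableSet := measurableSet_superlevel_of_tendstoUniformlyOn measurableSet_ball one_pos
        (fun ε hε => (hU ε hε).1) (hlim.mono (ball_subset_ball (by norm_num)))
      estimate := hmeasure
      estimate_sub := hsub
      exists_le := ⟨y, hy, by linarith⟩ } hbdd x hx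
  rwa [mul_add, mul_div_cancel₀ _ hC.ne'] at this
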